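/- arXiv:1607.07069 — 2 statements merged into one kernel-verified Lean document; each statement's English description precedes it below -/
import Mathlib

section
/- Let d ≥ 2 and let Δ be a finite, pure d-dimensional simplicial complex such that for every (d−2)-dimensional face σ of Δ, the link lk_Δ(σ) is a connected graph on at least two vertices whose normalized Laplacian spectral gap satisfies λ₂(lk_Δ(σ)) > 1 − 1/d. Then H_{d−1}(Δ, ℝ) = 0. -/
open MeasureTheory Filter Finset Matrix

noncomputable section

/-- Bernoulli measure on `Bool` with success probability `p` (clamped to `[0,1]`). -/
def bernoulliBool (p : ℝ) : Measure Bool :=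
  ENNReal.ofReal (max 0 (min p 1)) • Measure.dirac true +
    ENNReal.ofReal (1 - max 0 (min p 1)) • Measure.dirac false

instance (p : ℝ) : IsFiniteMeasure (bernoulliBool p) := by
  constructor
  simp only [bernoulliBool, Measure.add_apply, Measure.smul_apply, smul_eq_mul,
    measure_univ, mul_one]
  exact ENNReal.add_lt_top.mpr ⟨ENNReal.ofReal_lt_top, ENNReal.ofReal_lt_top⟩

/-- Index type for potential `d`-dimensional faces on vertex set `Fin n`:
the `(d+1)`-element subsets. -/
abbrev FaceIdx (n d : ℕ) : Type := {s : Finset (Fin n) // s.card = d + 1}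

/-- The distribution of the random `d`-complex `Y_d(n,p)`: each potential `d`-face
gets an independent Bernoulli(`p`) coin. (For `d = 1` this is the Erdős–Rényi model
`G(n,p)`.) -/
def YMeasure (n d : ℕ) (p : ℝ) : Measure (FaceIdx n d → Bool) :=
  Measure.pi fun _ => bernoulliBool p

/-- The random `d`-complex: all faces of dimension `≤ d - 1` (i.e. all subsets of
cardinality `≤ d`, including `∅`, so that degree-0 homology below is reduced
homology), together with the chosen `d`-faces. -/
def Ycomplex (n d : ℕ) (ω : FaceIdx n d → Bool) : Finset (Finset (Fin n)) :=
  Finset.univ.filter fun s => s.card ≤ d ∨ ∃ h : s.card = d + 1, ω ⟨s, h⟩ = true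

/-- The Erdős–Rényi random graph associated to a configuration of edge coins. -/
def graphOf (n : ℕ) (ω : FaceIdx n 1 → Bool) : SimpleGraph (Fin n) where
  Adj i j := i ≠ j ∧ ∃ e : FaceIdx n 1, ω e = true ∧ i ∈ e.1 ∧ j ∈ e.1
  symm := ⟨fun i j ⟨hne, e, he, hi, hj⟩ => ⟨hne.symm, e, he, hj, hi⟩⟩
  loopless := ⟨fun i ⟨hne, _⟩ => hne rfl⟩

instance (n : ℕ) (ω : FaceIdx n 1 → Bool) : DecidableRel (graphOf n ω).Adj :=
  fun i j =>
    inferInstanceAs (Decidable (i ≠ j ∧ ∃ e : FaceIdx n 1, ω e = true ∧ i ∈ e.1 ∧ j ∈ e.1))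

/-- The clique complex of the graph determined by the edge coins `ω`:
faces are vertex sets of complete subgraphs (including `∅` and singletons). -/
def cliqueComplex (n : ℕ) (ω : FaceIdx n 1 → Bool) : Finset (Finset (Fin n)) :=
  Finset.univ.filter fun s => ∀ i ∈ s, ∀ j ∈ s, i ≠ j → (graphOf n ω).Adj i j

/-- The group of simplicial `G`-chains of a complex `K`, in cardinality `c`
(i.e. dimension `c - 1`): functions on the faces of `K` of cardinality `c`. -/
abbrev Chains {V : Type} [Fintype V] [DecidableEq V]
    (K : Finset (Finset V)) (c : ℕ) (G : Type) : Type :=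
  {s : Finset V // s ∈ K ∧ s.card = c} → G

/-- The simplicial boundary map, from chains of cardinality `c+1` to chains of
cardinality `c`, with the usual alternating signs coming from the linear order
on the vertices. -/
def chainBoundary {V : Type} [Fintype V] [DecidableEq V] [LinearOrder V]
    (K : Finset (Finset V)) (c : ℕ) {G : Type} [AddCommGroup G]
    (f : Chains K (c + 1) G) : Chains K c G :=
  fun τ => ∑ v : V,
    if h : v ∉ τ.1 ∧ insert v τ.1 ∈ K then
      ((-1 : ℤ) ^ (τ.1.filter (fun u => u < v)).card) •
        f ⟨insert v τ.1, h.2, by rw [Finset.card_insert_of_notMem h.1, τ.2.2]⟩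
    else 0

/-- Vanishing of the simplicial homology of `K` with coefficients in `G` in
degree `i` (faces of cardinality `i+1`): every cycle is a boundary.
If `∅ ∈ K` this is reduced homology (the boundary map to cardinality-0 chains
is the augmentation); in degrees `i ≥ 1` reduced and unreduced homology agree. -/
def HomologyZero {V : Type} [Fintype V] [DecidableEq V] [LinearOrder V]
    (K : Finset (Finset V)) (i : ℕ) (G : Type) [AddCommGroup G] : Prop :=
  ∀ f : Chains K (i + 1) G, chainBoundary K i f = 0 →
    ∃ g : Chains K (i + 2) G, chainBoundary K (i + 1) g = f

/-- Vanishing of top-dimensional homology `H_d(K,G)`, i.e. the kernel of the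
`d`-th boundary map is zero. -/
def TopHomologyZero {V : Type} [Fintype V] [DecidableEq V] [LinearOrder V]
    (K : Finset (Finset V)) (d : ℕ) (G : Type) [AddCommGroup G] : Prop :=
  ∀ f : Chains K (d + 1) G, chainBoundary K d f = 0 → f = 0

/-- The boundary map on real coefficients, as a linear map. -/
def chainBoundaryLin {V : Type} [Fintype V] [DecidableEq V] [LinearOrder V]
    (K : Finset (Finset V)) (c : ℕ) : Chains K (c + 1) ℝ →ₗ[ℝ] Chains K c ℝ where
  toFun := chainBoundary K c
  map_add' f g := by
    funext τ
    simp only [chainBoundary, Pi.add_apply]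
    rw [← Finset.sum_add_distrib]
    refine Finset.sum_congr rfl fun v _ => ?_
    split
    · simp [smul_add]
    · simp
  map_smul' r f := by
    funext τ
    simp only [chainBoundary, Pi.smul_apply, RingHom.id_apply]
    rw [Finset.smul_sum]
    refine Finset.sum_congr rfl fun v _ => ?_
    split
    · exact smul_comm _ _ _
    · simp

/-- The `k`-th Betti number of `K`: the dimension of the `k`-th real simplicial
homology, i.e. of (kernel of `∂_k`) / (image of `∂_{k+1}`). -/
def bettiNumber {V : Type} [Fintype V] [DecidableEq V] [LinearOrder V]
    (K : Finset (Finset V)) (k : ℕ) : ℕ :=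
  Module.finrank ℝ
    (↥(LinearMap.ker (chainBoundaryLin K k)) ⧸
      (LinearMap.range (chainBoundaryLin K (k + 1))).comap
        (LinearMap.ker (chainBoundaryLin K k)).subtype)

/-- The link of a face `σ` in the complex `K`. -/
def linkSet {V : Type} [Fintype V] [DecidableEq V]
    (K : Finset (Finset V)) (σ : Finset V) : Finset (Finset V) :=
  Finset.univ.filter fun τ => τ ∩ σ = ∅ ∧ τ ∪ σ ∈ K

/-- The graph underlying the link of a face `σ`: its vertices are the vertices
of the link, joined when they span an edge of the link. -/
def linkGraph {V : Type} [Fintype V] [DecidableEq V]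
    (K : Finset (Finset V)) (σ : Finset V) :
    SimpleGraph {v : V // {v} ∈ linkSet K σ} where
  Adj a b := a ≠ b ∧ ({a.1, b.1} : Finset V) ∈ linkSet K σ
  symm := ⟨fun a b ⟨hab, h⟩ => ⟨hab.symm, by rwa [Finset.pair_comm]⟩⟩
  loopless := ⟨fun a ⟨hab, _⟩ => hab rfl⟩

instance {V : Type} [Fintype V] [DecidableEq V] (K : Finset (Finset V)) (σ : Finset V) :
    DecidableRel (linkGraph K σ).Adj :=
  fun a b => inferInstanceAs (Decidable (a ≠ b ∧ ({a.1, b.1} : Finset V) ∈ linkSet K σ))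

/-- The normalized Laplacian `I - D^{-1/2} A D^{-1/2}` of a finite graph. -/
def normalizedLaplacian {W : Type} [Fintype W] [DecidableEq W]
    (H : SimpleGraph W) [DecidableRel H.Adj] : Matrix W W ℝ :=
  Matrix.of fun a b =>
    (if a = b then (1 : ℝ) else 0) -
      (if H.Adj a b then 1 / Real.sqrt ((H.degree a : ℝ) * (H.degree b : ℝ)) else 0)

/-- An elementary `d`-collapse step: remove a free `(d-1)`-face `σ` together with
the unique `d`-face `τ` containing it. -/
def CollapseStep {V : Type} [DecidableEq V] (d : ℕ) (K K' : Finset (Finset V)) : Prop :=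
  ∃ σ τ : Finset V, σ ∈ K ∧ τ ∈ K ∧ τ.card = d + 1 ∧ σ ⊆ τ ∧ σ.card = d ∧
    (∀ ρ ∈ K, σ ⊆ ρ → ρ.card = d + 1 → ρ = τ) ∧ K' = K \ {σ, τ}

/-- `K` is `d`-collapsible if some finite sequence of elementary collapses reduces it
to a complex of dimension at most `d-1`. -/
def IsDCollapsible {V : Type} [DecidableEq V] (d : ℕ) (K : Finset (Finset V)) : Prop :=
  ∃ K' : Finset (Finset V),
    Relation.ReflTransGen (CollapseStep d) K K' ∧ ∀ s ∈ K', s.card ≤ d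

/-- The geometric realization of a complex on vertex set `Fin n`, inside `ℝ^n`:
the union over the faces of the convex hulls of the corresponding standard
basis vectors. -/
def geomReal (n : ℕ) (K : Finset (Finset (Fin n))) : Set (Fin n → ℝ) :=
  ⋃ σ ∈ K, convexHull ℝ ((fun i => (Pi.single i 1 : Fin n → ℝ)) '' ↑σ)

/-- The boundary of the simplex on the vertex set `τ`, as a chain of cardinality
`c` (to be used with `τ.card = c + 1`): the alternating sum of the `c`-element
subsets of `τ`. -/
def simplexBoundaryChain {V : Type} [Fintype V] [DecidableEq V] [LinearOrder V]
    (K : Finset (Finset V)) (c : ℕ) (τ : Finset V) : Chains K c ℝ :=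
  fun σ => ∑ v ∈ τ,
    if σ.1 = τ.erase v then ((-1 : ℝ) ^ (τ.filter (fun u => u < v)).card) else 0

/-- Index type for the multiparameter model: all potential faces of dimension `≥ 1`. -/
abbrev MultiIdx (n : ℕ) : Type := {s : Finset (Fin n) // 2 ≤ s.card}

/-- The distribution of the multiparameter random complex `X(n; p₁, p₂, …)`:
a potential face of cardinality `i+1` gets an independent Bernoulli(`p i`) coin. -/
def multiMeasure (n : ℕ) (p : ℕ → ℝ) : Measure (MultiIdx n → Bool) :=
  Measure.pi fun t => bernoulliBool (p (t.1.card - 1))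

/-- The multiparameter random complex: a set `s` is a face iff every subset of `s`
of dimension `≥ 1` has its coin turned on (this is exactly the
inductive-by-dimension construction: a face is present iff its coin is on and all
of its boundary faces are present). -/
def multiComplex (n : ℕ) (ω : MultiIdx n → Bool) : Finset (Finset (Fin n)) :=
  Finset.univ.filter fun s => ∀ t : MultiIdx n, t.1 ⊆ s → ω t = true

/-- The Vietoris–Rips complex of the points `pts` at scale `r`. -/
def VRcomplex (n d : ℕ) (pts : Fin n → EuclideanSpace ℝ (Fin d)) (r : ℝ) :
    Finset (Finset (Fin n)) :=
  Finset.univ.filter fun s => ∀ i ∈ s, ∀ j ∈ s, dist (pts i) (pts j) ≤ r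

end

noncomputable section
lemma normLap_mulVec {W : Type} [Fintype W] [DecidableEq W]
    (H : SimpleGraph W) [DecidableRel H.Adj] (hdeg : ∀ a, 0 < H.degree a) (x : W → ℝ) (a : W) :
    (normalizedLaplacian H).mulVec (fun b => Real.sqrt (H.degree b) * x b) a
      = (Real.sqrt (H.degree a))⁻¹ * (H.lapMatrix ℝ).mulVec x a := by
  have hs : ∀ b, 0 < Real.sqrt (H.degree b : ℝ) := fun b =>
    Real.sqrt_pos.mpr (by exact_mod_cast hdeg b)
  rw [SimpleGraph.lapMatrix_mulVec_apply]
  simp only [normalizedLaplacian, Matrix.mulVec, dotProduct, Matrix.of_apply, sub_mul,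
    Finset.sum_sub_distrib, ite_mul, one_mul, zero_mul, Finset.sum_ite_eq, Finset.mem_univ, if_true]
  rw [mul_sub, Finset.mul_sum]
  congr 1
  · have h1 := hs a
    have h2 : (H.degree a : ℝ) = Real.sqrt (H.degree a) * Real.sqrt (H.degree a) :=
      (Real.mul_self_sqrt (by positivity)).symm
    nth_rewrite 3 [h2]
    field_simp
  · rw [← Finset.sum_filter, ← SimpleGraph.neighborFinset_eq_filter]
    refine Finset.sum_congr rfl fun b _ => ?_
    have h1 := hs a
    have h2 := hs b
    rw [Real.sqrt_mul (by positivity)]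
    field_simp

lemma normLap_isHermitian {W : Type} [Fintype W] [DecidableEq W]
    (H : SimpleGraph W) [DecidableRel H.Adj] : (normalizedLaplacian H).IsHermitian := by
  ext a b
  simp [normalizedLaplacian, H.adj_comm a b, eq_comm (a := a) (b := b), mul_comm]

lemma spectral_gap {W : Type} [Fintype W] [DecidableEq W]
    (H : SimpleGraph W) [DecidableRel H.Adj] (hc : H.Connected) (hdeg : ∀ a, 0 < H.degree a)
    (c : ℝ)
    (hgap : ∀ μ : ℝ, (∃ x : W → ℝ, x ≠ 0 ∧ (normalizedLaplacian H).mulVec x = μ • x) →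
      μ = 0 ∨ c < μ)
    (x : W → ℝ) (hx : ∑ a, (H.degree a : ℝ) * x a = 0) (hx0 : x ≠ 0) :
    2 * c * ∑ a, (H.degree a : ℝ) * x a ^ 2
      < ∑ a, ∑ b, if H.Adj a b then (x a - x b) ^ 2 else 0 := by
  have hs : ∀ b, 0 < Real.sqrt (H.degree b : ℝ) := fun b =>
    Real.sqrt_pos.mpr (by exact_mod_cast hdeg b)
  have hss : ∀ b, Real.sqrt (H.degree b) * Real.sqrt (H.degree b) = (H.degree b : ℝ) := fun b =>
    Real.mul_self_sqrt (by positivity)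
  have hA := normLap_isHermitian H
  set A := normalizedLaplacian H with hAdef
  set y : W → ℝ := fun b => Real.sqrt (H.degree b) * x b with hy
  let B := hA.eigenvectorBasis
  let Y : EuclideanSpace ℝ W := WithLp.toLp 2 y
  have hB : ∀ i, A.mulVec (B i) = hA.eigenvalues i • (B i : W → ℝ) := hA.mulVec_eigenvectorBasis
  have hin : ∀ (u v : EuclideanSpace ℝ W), inner ℝ u v = ∑ a, u a * v a := by
    intro u v
    simp [PiLp.inner_apply, mul_comm]
  have hBne : ∀ i, (B i : W → ℝ) ≠ 0 := by
    intro i h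
    have h1 := B.orthonormal.1 i
    have : B i = 0 := by
      ext a; exact congrFun h a
    rw [this] at h1; simp at h1
  -- quadratic form
  have hq : ∑ a, y a * A.mulVec y a
      = (∑ a, ∑ b, if H.Adj a b then (x a - x b) ^ 2 else 0) / 2 := by
    rw [← SimpleGraph.lapMatrix_toLinearMap₂', Matrix.toLinearMap₂'_apply']
    simp only [dotProduct]
    refine Finset.sum_congr rfl fun a _ => ?_
    rw [hy, hAdef, normLap_mulVec H hdeg]
    have := hs a
    field_simp
  have hn : ∑ a, y a * y a = ∑ a, (H.degree a : ℝ) * x a ^ 2 := by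
    refine Finset.sum_congr rfl fun a _ => ?_
    rw [← hss a]; simp only [hy]; ring
  have hYA : ∀ i, inner ℝ (B i) (WithLp.toLp 2 (A.mulVec y) : EuclideanSpace ℝ W)
      = hA.eigenvalues i * inner ℝ (B i) Y := by
    intro i
    rw [hin, hin]
    have h1 : ∑ a, (B i) a * A.mulVec y a = ∑ a, A.mulVec (B i) a * y a := by
      change (B i : W → ℝ) ⬝ᵥ (A *ᵥ y) = (A *ᵥ (B i : W → ℝ)) ⬝ᵥ y
      rw [Matrix.dotProduct_mulVec, ← Matrix.mulVec_transpose]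
      have : Aᵀ = A := by
        have := hA.eq
        rwa [Matrix.conjTranspose_eq_transpose_of_trivial] at this
      rw [this]
    refine h1.trans ?_
    rw [hB i, Finset.mul_sum]
    refine Finset.sum_congr rfl fun a _ => ?_
    simp [Y, mul_assoc]
  have hq2 : ∑ a, y a * A.mulVec y a = ∑ i, hA.eigenvalues i * (inner ℝ (B i) Y) ^ 2 := by
    have := B.sum_inner_mul_inner Y (WithLp.toLp 2 (A.mulVec y) : EuclideanSpace ℝ W)
    rw [hin Y] at this
    refine Eq.trans this.symm ?_
    refine Finset.sum_congr rfl fun i _ => ?_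
    rw [hYA i, real_inner_comm]; ring
  have hn2 : ∑ a, y a * y a = ∑ i, (inner ℝ (B i) Y) ^ 2 := by
    have := B.sum_inner_mul_inner Y Y
    rw [hin Y] at this
    refine Eq.trans this.symm ?_
    refine Finset.sum_congr rfl fun i _ => ?_
    rw [real_inner_comm]; ring
  have hker : ∀ i, hA.eigenvalues i = 0 → inner ℝ (B i) Y = 0 := by
    intro i hi
    have h0 := hB i
    rw [hi, zero_smul] at h0
    let z : W → ℝ := fun a => (Real.sqrt (H.degree a))⁻¹ * (B i) a
    have hz : (fun b => Real.sqrt (H.degree b) * z b) = (B i : W → ℝ) := by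
      funext b
      have := hs b
      simp only [z]
      field_simp
    have hL : (H.lapMatrix ℝ).mulVec z = 0 := by
      funext a
      have h2 := normLap_mulVec H hdeg z a
      rw [hz, ← hAdef, h0] at h2
      have := hs a
      simp only [Pi.zero_apply] at h2 ⊢
      rcases mul_eq_zero.mp h2.symm with h3 | h3
      · exact absurd h3 (inv_ne_zero this.ne')
      · exact h3
    have hconst := (SimpleGraph.lapMatrix_mulVec_eq_zero_iff_forall_reachable H).mp hL
    obtain ⟨a0⟩ := hc.nonempty
    rw [hin]
    have : ∀ a, (B i) a * Y a = z a0 * ((H.degree a : ℝ) * x a) := by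
      intro a
      rw [hconst a0 a (hc.preconnected a0 a), ← hss a]
      have := congrFun hz a
      rw [← this]
      simp only [Y, hy]
      ring
    rw [Finset.sum_congr rfl fun a _ => this a, ← Finset.mul_sum, hx, mul_zero]
  have hY0 : ∃ i, inner ℝ (B i) Y ≠ 0 := by
    by_contra! hcon
    have : ∑ a, y a * y a = 0 := by rw [hn2]; simp [hcon]
    rw [Finset.sum_eq_zero_iff_of_nonneg (fun a _ => mul_self_nonneg _)] at this
    apply hx0
    funext a
    have h1 := mul_self_eq_zero.mp (this a (Finset.mem_univ a))
    exact (mul_eq_zero.mp h1).resolve_left (hs a).ne'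
  have hstrict : c * ∑ i, (inner ℝ (B i) Y) ^ 2 < ∑ i, hA.eigenvalues i * (inner ℝ (B i) Y) ^ 2 := by
    rw [Finset.mul_sum]
    have key : ∀ i, inner ℝ (B i) Y ≠ 0 → c < hA.eigenvalues i := by
      intro i hi
      rcases hgap _ ⟨B i, hBne i, hB i⟩ with h | h
      · exact absurd (hker i h) hi
      · exact h
    obtain ⟨i0, hi0⟩ := hY0
    refine Finset.sum_lt_sum (fun i _ => ?_) ⟨i0, Finset.mem_univ _, ?_⟩
    · by_cases h : inner ℝ (B i) Y = 0
      · simp [h]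
      · exact mul_le_mul_of_nonneg_right (key i h).le (sq_nonneg _)
    · exact mul_lt_mul_of_pos_right (key i0 hi0) (by positivity)
  rw [← hn, hn2]
  rw [← hq2, hq] at hstrict
  linarith

lemma weighted_proj {ι κ : Type} [Fintype ι] [Fintype κ] (A : (κ → ℝ) →ₗ[ℝ] (ι → ℝ))
    (w : ι → ℝ) (hw : ∀ i, 0 < w i) (f : ι → ℝ) :
    ∃ g : κ → ℝ, ∀ g' : κ → ℝ, ∑ i, (f i - A g i) / w i * A g' i = 0 := by
  have hs : ∀ b, 0 < Real.sqrt (w b) := fun b => Real.sqrt_pos.mpr (hw b)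
  have hss : ∀ b, Real.sqrt (w b) * Real.sqrt (w b) = w b := fun b =>
    Real.mul_self_sqrt (hw b).le
  let S : (ι → ℝ) →ₗ[ℝ] EuclideanSpace ℝ ι :=
    { toFun := fun v => WithLp.toLp 2 (fun i => (Real.sqrt (w i))⁻¹ * v i)
      map_add' := by intro u v; ext i; simp [mul_add]
      map_smul' := by intro r v; ext i; simp; ring }
  obtain ⟨p, hp, q, hq, hpq⟩ :=
    (LinearMap.range (S ∘ₗ A)).exists_add_mem_mem_orthogonal (S f)
  obtain ⟨g, rfl⟩ := hp
  refine ⟨g, fun g' => ?_⟩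
  have h := (Submodule.mem_orthogonal' _ _).mp hq ((S ∘ₗ A) g') ⟨g', rfl⟩
  have hq' : q = S f - (S ∘ₗ A) g := by rw [hpq]; abel
  rw [hq', PiLp.inner_apply] at h
  rw [← h]
  refine Finset.sum_congr rfl fun i _ => ?_
  have h1 := hs i
  rw [← hss i]
  simp [S]
  field_simp

def gSg {n : ℕ} (τ : Finset (Fin n)) (v : Fin n) : ℝ :=
  (-1) ^ (τ.filter (fun u => u < v)).card

lemma gSg_sq {n : ℕ} (τ : Finset (Fin n)) (v : Fin n) : gSg τ v * gSg τ v = 1 := by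
  simp only [gSg]
  rw [← mul_pow]; norm_num

lemma gSg_anti {n : ℕ} (σ : Finset (Fin n)) (a b : Fin n) (hab : a ≠ b) (ha : a ∉ σ)
    (hb : b ∉ σ) :
    gSg σ a * gSg (insert a σ) b = - (gSg σ b * gSg (insert b σ) a) := by
  have h1 : ∀ a b : Fin n, a ∉ σ → gSg (insert a σ) b = (if a < b then -1 else 1) * gSg σ b := by
    intro a b ha
    simp only [gSg, Finset.filter_insert]
    split_ifs with h
    · rw [Finset.card_insert_of_notMem (by simp [ha]), pow_succ]; ring
    · ring
  rw [h1 a b ha, h1 b a hb]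
  rcases lt_or_gt_of_ne hab with h | h
  · rw [if_pos h, if_neg h.not_gt]; ring
  · rw [if_pos h, if_neg h.not_gt]; ring

def gExt {n : ℕ} {K : Finset (Finset (Fin n))} {c : ℕ} (f : Chains K c ℝ)
    (s : Finset (Fin n)) : ℝ := if h : s ∈ K ∧ s.card = c then f ⟨s, h⟩ else 0

lemma bd_eq {n : ℕ} {K : Finset (Finset (Fin n))} {c : ℕ} (f : Chains K (c + 1) ℝ)
    (τ : {s : Finset (Fin n) // s ∈ K ∧ s.card = c}) :
    chainBoundary K c f τ
      = ∑ v, if v ∉ τ.1 then gSg τ.1 v * gExt f (insert v τ.1) else 0 := by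
  simp only [chainBoundary]
  refine Finset.sum_congr rfl fun v _ => ?_
  by_cases h1 : v ∉ τ.1
  · rw [if_pos h1]
    by_cases h2 : insert v τ.1 ∈ K
    · rw [dif_pos ⟨h1, h2⟩]
      have : insert v τ.1 ∈ K ∧ (insert v τ.1).card = c + 1 :=
        ⟨h2, by rw [Finset.card_insert_of_notMem h1, τ.2.2]⟩
      rw [gExt, dif_pos this, gSg]
      simp
    · rw [dif_neg (fun h => h2 h.2), gExt, dif_neg (fun h => h2 h.1), mul_zero]
  · rw [if_neg h1, dif_neg (fun h => h1 h.1)]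

lemma bd_bd {n : ℕ} {K : Finset (Finset (Fin n))} {c : ℕ}
    (hcplx : ∀ s ∈ K, ∀ t ⊆ s, t.Nonempty → t ∈ K) (g : Chains K (c + 1 + 1) ℝ) :
    chainBoundary K c (chainBoundary K (c + 1) g) = 0 := by
  funext σ
  rw [bd_eq]
  have h1 : ∀ a, a ∉ σ.1 → gExt (chainBoundary K (c + 1) g) (insert a σ.1)
      = ∑ b, if b ∉ insert a σ.1 then
          gSg (insert a σ.1) b * gExt g (insert b (insert a σ.1)) else 0 := by
    intro a ha
    by_cases h : insert a σ.1 ∈ K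
    · rw [gExt, dif_pos ⟨h, by rw [Finset.card_insert_of_notMem ha, σ.2.2]⟩, bd_eq]
    · rw [gExt, dif_neg (fun h' => h h'.1)]
      symm
      refine Finset.sum_eq_zero fun b _ => ?_
      rw [gExt, dif_neg]
      · simp
      · intro h'
        exact h (hcplx _ h'.1 _ (Finset.subset_insert _ _) (Finset.insert_nonempty _ _))
  let T : Fin n → Fin n → ℝ := fun a b =>
    if a ∉ σ.1 ∧ b ∉ σ.1 ∧ a ≠ b then
      gSg σ.1 a * gSg (insert a σ.1) b * gExt g (insert b (insert a σ.1)) else 0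
  have h2 : (∑ v, if v ∉ σ.1 then gSg σ.1 v * gExt (chainBoundary K (c + 1) g) (insert v σ.1)
      else 0) = ∑ a, ∑ b, T a b := by
    refine Finset.sum_congr rfl fun a _ => ?_
    by_cases ha : a ∈ σ.1
    · simp [T, ha]
    · rw [if_pos ha, h1 a ha, Finset.mul_sum]
      refine Finset.sum_congr rfl fun b _ => ?_
      simp only [T, ha, Finset.mem_insert, not_or, not_false_eq_true, true_and]
      by_cases hb : b ∈ σ.1
      · simp [hb]
      · by_cases hab : a = b
        · simp [hab]
        · simp [hb, hab, Ne.symm hab, mul_assoc]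
  have h3 : ∀ a b, T a b = - T b a := by
    intro a b
    simp only [T]
    by_cases h : a ∉ σ.1 ∧ b ∉ σ.1 ∧ a ≠ b
    · rw [if_pos h, if_pos ⟨h.2.1, h.1, h.2.2.symm⟩, gSg_anti σ.1 a b h.2.2 h.1 h.2.1,
        Finset.insert_comm]
      ring
    · rw [if_neg h, if_neg (fun h' => h ⟨h'.2.1, h'.1, h'.2.2.symm⟩)]; simp
  rw [h2]
  have h4 : ∑ a, ∑ b, T a b = - ∑ a, ∑ b, T a b := by
    conv_lhs => rw [Finset.sum_comm]
    rw [← Finset.sum_neg_distrib]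
    refine Finset.sum_congr rfl fun a _ => ?_
    rw [← Finset.sum_neg_distrib]
    exact Finset.sum_congr rfl fun b _ => h3 b a
  simp only [Pi.zero_apply]
  linarith

lemma cocycle_eq {n : ℕ} {K : Finset (Finset (Fin n))} {c : ℕ}
    (hcplx : ∀ s ∈ K, ∀ t ⊆ s, t.Nonempty → t ∈ K) (φ : Chains K (c + 1) ℝ)
    (h : ∀ g' : Chains K (c + 1 + 1) ℝ, ∑ τ, φ τ * chainBoundary K (c + 1) g' τ = 0)
    (ρ : Finset (Fin n)) (hρ : ρ ∈ K) (hc : ρ.card = c + 2) :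
    ∑ a ∈ ρ, gSg (ρ.erase a) a * gExt φ (ρ.erase a) = 0 := by
  have h0 := h (Pi.single ⟨ρ, hρ, hc⟩ 1)
  rw [← h0]
  simp only [bd_eq, Finset.mul_sum]
  rw [Finset.sum_comm, ← Finset.sum_filter_add_sum_filter_not Finset.univ (fun a => a ∈ ρ)]
  have hE : ∀ s : Finset (Fin n),
      gExt (Pi.single ⟨ρ, hρ, hc⟩ 1 : Chains K (c + 1 + 1) ℝ) s = if s = ρ then 1 else 0 := by
    intro s
    simp only [gExt]
    by_cases hs : s = ρ
    · subst hs
      rw [dif_pos ⟨hρ, hc⟩]; simp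
    · rw [if_neg hs]
      split_ifs with h'
      · rw [Pi.single_eq_of_ne]
        intro he
        exact hs (congrArg Subtype.val he)
      · rfl
  simp only [hE]
  have hz : ∑ v with v ∉ ρ, ∑ τ : {s : Finset (Fin n) // s ∈ K ∧ s.card = c + 1},
      φ τ * (if v ∉ τ.1 then gSg τ.1 v * (if insert v τ.1 = ρ then 1 else 0) else 0) = 0 := by
    refine Finset.sum_eq_zero fun v hv => Finset.sum_eq_zero fun τ _ => ?_
    have hv : v ∉ ρ := by simpa using hv
    have : insert v τ.1 ≠ ρ := fun h => hv (h ▸ Finset.mem_insert_self _ _)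
    simp [this]
  rw [hz, add_zero]
  refine Finset.sum_congr (by ext; simp) fun v hv => ?_
  have hv : v ∈ ρ := by simpa using hv
  have hcard : (ρ.erase v).card = c + 1 := by rw [Finset.card_erase_of_mem hv, hc]; rfl
  have hK : ρ.erase v ∈ K :=
    hcplx _ hρ _ (Finset.erase_subset _ _) (Finset.card_pos.mp (by omega))
  rw [Fintype.sum_eq_single ⟨ρ.erase v, hK, hcard⟩]
  · rw [gExt, dif_pos ⟨hK, hcard⟩]
    simp [Finset.insert_erase hv, mul_comm]
  · intro τ hτ
    by_cases h1 : v ∈ τ.1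
    · simp [h1]
    · have : insert v τ.1 ≠ ρ := by
        intro he
        apply hτ
        apply Subtype.ext
        simp only
        rw [← he, Finset.erase_insert h1]
      simp [this]

abbrev gT {n : ℕ} (K : Finset (Finset (Fin n))) (σ : Finset (Fin n)) (a b : Fin n) : Prop :=
  a ∉ σ ∧ b ∉ σ ∧ a ≠ b ∧ insert a (insert b σ) ∈ K

def gW {n : ℕ} (K : Finset (Finset (Fin n))) (τ : Finset (Fin n)) : ℝ :=
  ∑ b, if b ∉ τ ∧ insert b τ ∈ K then 1 else 0

lemma sum_sub {n : ℕ} (P : Fin n → Prop) [DecidablePred P] (g : Fin n → ℝ) :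
    ∑ a : {v // P v}, g a.1 = ∑ a, if P a then g a else 0 := by
  rw [← Finset.sum_filter]
  exact (Finset.sum_subtype (Finset.univ.filter P) (by simp) g).symm

lemma local_gap {n : ℕ} (K : Finset (Finset (Fin n)))
    (hcplx : ∀ s ∈ K, ∀ t ⊆ s, t.Nonempty → t ∈ K) (σ : Finset (Fin n)) (c : ℝ)
    (hconn : (linkGraph K σ).Connected)
    (hcard : 2 ≤ Fintype.card {v : Fin n // {v} ∈ linkSet K σ})
    (hgap : ∀ μ : ℝ, (∃ x : {v : Fin n // {v} ∈ linkSet K σ} → ℝ, x ≠ 0 ∧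
          (normalizedLaplacian (linkGraph K σ)).mulVec x = μ • x) → μ = 0 ∨ c < μ)
    (X : Fin n → ℝ)
    (hX : (∑ v, if v ∉ σ ∧ insert v σ ∈ K then gW K (insert v σ) * X v else 0) = 0)
    (hX0 : ∃ v, v ∉ σ ∧ insert v σ ∈ K ∧ X v ≠ 0) :
    2 * c * (∑ a, ∑ b, if gT K σ a b then X a ^ 2 else 0)
      < ∑ a, ∑ b, if gT K σ a b then (X a - X b) ^ 2 else 0 := by
  have hmem : ∀ v, {v} ∈ linkSet K σ ↔ v ∉ σ ∧ insert v σ ∈ K := by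
    intro v
    simp [linkSet, ← Finset.disjoint_iff_inter_eq_empty]
  have hadj : ∀ a b, (linkGraph K σ).Adj a b ↔ gT K σ a.1 b.1 := by
    intro a b
    have ha := (hmem a.1).mp a.2
    have hb := (hmem b.1).mp b.2
    have h1 : ({a.1, b.1} : Finset (Fin n)) ∩ σ = ∅ := by
      rw [← Finset.disjoint_iff_inter_eq_empty]
      simp [ha.1, hb.1]
    have h2 : ({a.1, b.1} : Finset (Fin n)) ∪ σ = insert a.1 (insert b.1 σ) := by
      ext; simp
    simp [linkGraph, linkSet, h1, ha.1, hb.1, gT, Subtype.ext_iff]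
  have hTl : ∀ a b, gT K σ a b → {a} ∈ linkSet K σ ∧ {b} ∈ linkSet K σ := by
    rintro a b ⟨ha, hb, hab, h⟩
    refine ⟨(hmem a).mpr ⟨ha, hcplx _ h _ ?_ (Finset.insert_nonempty _ _)⟩,
      (hmem b).mpr ⟨hb, hcplx _ h _ (Finset.subset_insert _ _) (Finset.insert_nonempty _ _)⟩⟩
    intro u; simp; tauto
  have hdbl : ∀ g : Fin n → Fin n → ℝ,
      (∑ a : {v // {v} ∈ linkSet K σ}, ∑ b : {v // {v} ∈ linkSet K σ},
        if (linkGraph K σ).Adj a b then g a.1 b.1 else 0)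
      = ∑ a, ∑ b, if gT K σ a b then g a b else 0 := by
    intro g
    simp only [hadj]
    rw [sum_sub (fun v => {v} ∈ linkSet K σ)
      (fun a => ∑ b : {v // {v} ∈ linkSet K σ}, if gT K σ a b.1 then g a b.1 else 0)]
    refine Finset.sum_congr rfl fun a _ => ?_
    rw [sum_sub (fun v => {v} ∈ linkSet K σ) (fun b => if gT K σ a b then g a b else 0)]
    split_ifs with h
    · refine Finset.sum_congr rfl fun b _ => ?_
      by_cases hT : gT K σ a b
      · rw [if_pos (hTl a b hT).2]
      · simp [hT]
    · symm
      refine Finset.sum_eq_zero fun b _ => ?_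
      rw [if_neg (fun hT => h (hTl a b hT).1)]
  have hdegS : ∀ a, ((linkGraph K σ).degree a : ℝ)
      = ∑ b, if (linkGraph K σ).Adj a b then 1 else 0 := by
    intro a
    exact SimpleGraph.degree_eq_sum_if_adj (linkGraph K σ) a
  have hdeg : ∀ a, ((linkGraph K σ).degree a : ℝ) = gW K (insert a.1 σ) := by
    intro a
    rw [hdegS, gW]
    simp only [hadj]
    rw [sum_sub (fun v => {v} ∈ linkSet K σ) (fun b => if gT K σ a b then 1 else 0)]
    refine Finset.sum_congr rfl fun b _ => ?_
    have ha := (hmem a.1).mp a.2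
    have hiff : gT K σ a.1 b ↔ b ∉ insert a.1 σ ∧ insert b (insert a.1 σ) ∈ K := by
      rw [Finset.insert_comm b, gT]
      simp [ha.1]
      tauto
    by_cases hT : gT K σ a.1 b
    · rw [if_pos (hTl _ _ hT).2, if_pos hT, if_pos (hiff.mp hT)]
    · rw [if_neg (fun h => hT (hiff.mpr h))]; simp [hT]
  have : Nontrivial {v : Fin n // {v} ∈ linkSet K σ} :=
    Fintype.one_lt_card_iff_nontrivial.mp hcard
  have hpos : ∀ a, 0 < (linkGraph K σ).degree a := fun a =>
    hconn.preconnected.degree_pos_of_nontrivial a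
  have key := spectral_gap (linkGraph K σ) hconn hpos c hgap (fun a => X a.1) ?_ ?_
  · rw [hdbl (fun a b => (X a - X b) ^ 2)] at key
    rw [← hdbl (fun a b => X a ^ 2)]
    convert key using 3 with a
    rw [hdegS, Finset.sum_mul]
    refine Finset.sum_congr rfl fun b _ => ?_
    simp
  · simp only [hdeg]
    rw [sum_sub (fun v => {v} ∈ linkSet K σ) (fun a => gW K (insert a σ) * X a)]
    simp only [hmem]
    exact hX
  · obtain ⟨v, h1, h2, h3⟩ := hX0
    intro h
    exact h3 (congrFun h ⟨v, (hmem v).mpr ⟨h1, h2⟩⟩)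

lemma reindex {n e : ℕ} (K : Finset (Finset (Fin n)))
    (g : Finset (Fin n) → Fin n → Fin n → ℝ) :
    (∑ σ ∈ Finset.univ.filter (fun σ : Finset (Fin n) => σ.card = e),
      ∑ a, ∑ b, if gT K σ a b then g σ a b else 0)
    = ∑ ρ ∈ K.filter (fun ρ => ρ.card = e + 2),
      ∑ a, ∑ b, if a ∈ ρ ∧ b ∈ ρ ∧ a ≠ b then g ((ρ.erase a).erase b) a b else 0 := by
  rw [Finset.sum_comm]
  rw [Finset.sum_comm (s := K.filter (fun ρ => ρ.card = e + 2))]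
  refine Finset.sum_congr rfl fun a _ => ?_
  rw [Finset.sum_comm]
  rw [Finset.sum_comm (s := K.filter (fun ρ => ρ.card = e + 2))]
  refine Finset.sum_congr rfl fun b _ => ?_
  rw [← Finset.sum_filter, ← Finset.sum_filter]
  have hee : ∀ σ : Finset (Fin n), a ∉ σ → b ∉ σ → a ≠ b →
      ((insert a (insert b σ)).erase a).erase b = σ := by
    intro σ ha hb hab
    rw [Finset.erase_insert (by simp [ha, hab]), Finset.erase_insert hb]
  have hii : ∀ ρ : Finset (Fin n), a ∈ ρ → b ∈ ρ → a ≠ b →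
      insert a (insert b ((ρ.erase a).erase b)) = ρ := by
    intro ρ ha hb hab
    rw [Finset.insert_erase (by simp [hb, hab.symm]), Finset.insert_erase ha]
  refine Finset.sum_bij' (fun σ _ => insert a (insert b σ)) (fun ρ _ => (ρ.erase a).erase b)
    ?_ ?_ ?_ ?_ ?_
  · intro σ hσ
    simp only [Finset.mem_filter, Finset.mem_univ, true_and] at hσ ⊢
    obtain ⟨h1, ha, hb, hab, h⟩ := hσ
    refine ⟨⟨h, ?_⟩, by simp, by simp, hab⟩
    rw [Finset.card_insert_of_notMem (by simp [ha, hab]), Finset.card_insert_of_notMem hb, h1]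
  · intro ρ hρ
    simp only [Finset.mem_filter, Finset.mem_univ, true_and] at hρ ⊢
    obtain ⟨⟨h, h1⟩, ha, hb, hab⟩ := hρ
    refine ⟨?_, by simp, by simp, hab, by rwa [hii ρ ha hb hab]⟩
    rw [Finset.card_erase_of_mem (by simp [hb, hab.symm]), Finset.card_erase_of_mem ha, h1]
    rfl
  · intro σ hσ
    simp only [Finset.mem_filter, Finset.mem_univ, true_and] at hσ
    exact hee σ hσ.2.1 hσ.2.2.1 hσ.2.2.2.1
  · intro ρ hρ
    simp only [Finset.mem_filter] at hρ
    exact hii ρ hρ.2.1 hρ.2.2.1 hρ.2.2.2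
  · intro σ hσ
    simp only [Finset.mem_filter, Finset.mem_univ, true_and] at hσ
    rw [hee σ hσ.2.1 hσ.2.2.1 hσ.2.2.2.1]

lemma offdiag_sum {n : ℕ} (ρ : Finset (Fin n)) (h : Fin n → Fin n → ℝ) :
    (∑ a, ∑ b, if a ∈ ρ ∧ b ∈ ρ ∧ a ≠ b then h a b else 0)
      = ∑ a ∈ ρ, ∑ b ∈ ρ, h a b - ∑ a ∈ ρ, h a a := by
  rw [← Finset.sum_sub_distrib, ← Finset.sum_subset (Finset.subset_univ ρ)]
  · refine Finset.sum_congr rfl fun a ha => ?_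
    rw [eq_sub_iff_add_eq, ← Finset.sum_erase_add ρ _ ha]
    congr 1
    rw [← Finset.sum_filter]
    refine Finset.sum_congr ?_ fun _ _ => rfl
    ext b; simp [ha, eq_comm]; tauto
  · intro a _ ha
    simp [ha]

lemma gHarmonic_zero {n e : ℕ} (he : 1 ≤ e) (K : Finset (Finset (Fin n)))
    (hcplx : ∀ s ∈ K, ∀ t ⊆ s, t.Nonempty → t ∈ K)
    (hlink : ∀ σ ∈ K, σ.card = e →
      (linkGraph K σ).Connected ∧
      2 ≤ Fintype.card {v : Fin n // {v} ∈ linkSet K σ} ∧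
      ∀ μ : ℝ, (∃ x : {v : Fin n // {v} ∈ linkSet K σ} → ℝ, x ≠ 0 ∧
          (normalizedLaplacian (linkGraph K σ)).mulVec x = μ • x) →
        μ = 0 ∨ 1 - 1 / ((e + 1 : ℕ) : ℝ) < μ)
    (F : Finset (Fin n) → ℝ)
    (hco : ∀ ρ ∈ K, ρ.card = e + 2 → ∑ a ∈ ρ, gSg (ρ.erase a) a * F (ρ.erase a) = 0)
    (hcy : ∀ σ ∈ K, σ.card = e →
      (∑ v, if v ∉ σ ∧ insert v σ ∈ K then
        gW K (insert v σ) * (gSg σ v * F (insert v σ)) else 0) = 0)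
    (τ : Finset (Fin n)) (hτ : τ ∈ K) (hτc : τ.card = e + 1) : F τ = 0 := by
  set c : ℝ := 1 - 1 / ((e + 1 : ℕ) : ℝ) with hc
  let N : Finset (Fin n) → ℝ := fun σ =>
    ∑ a, ∑ b, if gT K σ a b then (gSg σ a * F (insert a σ)) ^ 2 else 0
  let E : Finset (Fin n) → ℝ := fun σ =>
    ∑ a, ∑ b, if gT K σ a b then (gSg σ a * F (insert a σ) - gSg σ b * F (insert b σ)) ^ 2 else 0
  have hTl : ∀ σ a b, gT K σ a b → insert a σ ∈ K ∧ insert b σ ∈ K := by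
    rintro σ a b ⟨ha, hb, hab, h⟩
    refine ⟨hcplx _ h _ ?_ (Finset.insert_nonempty _ _),
      hcplx _ h _ (Finset.subset_insert _ _) (Finset.insert_nonempty _ _)⟩
    intro u; simp; tauto
  have hstrict : ∀ σ ∈ K, σ.card = e →
      (∃ v, v ∉ σ ∧ insert v σ ∈ K ∧ gSg σ v * F (insert v σ) ≠ 0) → 2 * c * N σ < E σ := by
    intro σ hσ hσc hv
    obtain ⟨h1, h2, h3⟩ := hlink σ hσ hσc
    exact local_gap K hcplx σ c h1 h2 h3 (fun v => gSg σ v * F (insert v σ)) (hcy σ hσ hσc) hv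
  have hle : ∀ σ ∈ Finset.univ.filter (fun σ : Finset (Fin n) => σ.card = e),
      2 * c * N σ ≤ E σ := by
    intro σ hσ
    have hσc : σ.card = e := by simpa using hσ
    by_cases hv : ∃ v, v ∉ σ ∧ insert v σ ∈ K ∧ gSg σ v * F (insert v σ) ≠ 0
    · obtain ⟨v, h1, h2, h3⟩ := hv
      exact (hstrict σ (hcplx _ h2 _ (Finset.subset_insert _ _)
        (Finset.card_pos.mp (by omega))) hσc ⟨v, h1, h2, h3⟩).le
    · push Not at hv
      have hN : N σ = 0 := by
        refine Finset.sum_eq_zero fun a _ => Finset.sum_eq_zero fun b _ => ?_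
        split_ifs with h
        · rw [hv a h.1 (hTl _ _ _ h).1]; simp
        · rfl
      rw [hN, mul_zero]
      refine Finset.sum_nonneg fun a _ => Finset.sum_nonneg fun b _ => ?_
      split_ifs
      · positivity
      · exact le_rfl
  let Q : ℝ := ∑ ρ ∈ K.filter (fun ρ => ρ.card = e + 2), ∑ b ∈ ρ, F (ρ.erase b) ^ 2
  have hN : ∑ σ ∈ Finset.univ.filter (fun σ : Finset (Fin n) => σ.card = e), N σ
      = (e + 1) * Q := by
    simp only [N, Q]
    rw [reindex K (fun σ a b => (gSg σ a * F (insert a σ)) ^ 2), Finset.mul_sum]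
    refine Finset.sum_congr rfl fun ρ hρ => ?_
    have hρc : ρ.card = e + 2 := (Finset.mem_filter.mp hρ).2
    have : (∑ b ∈ ρ, F (ρ.erase b) ^ 2) * (e + 1) =
        ∑ a ∈ ρ, ∑ b ∈ ρ, F (ρ.erase b) ^ 2 - ∑ a ∈ ρ, F (ρ.erase a) ^ 2 := by
      rw [Finset.sum_const, hρc]; simp; ring
    rw [mul_comm, this, ← offdiag_sum ρ (fun a b => F (ρ.erase b) ^ 2)]
    refine Finset.sum_congr rfl fun a _ => Finset.sum_congr rfl fun b _ => ?_
    split_ifs with h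
    · obtain ⟨ha, hb, hab⟩ := h
      rw [Finset.erase_right_comm, Finset.insert_erase (by simp [ha, hab]), mul_pow, sq (gSg _ _),
        gSg_sq, one_mul]
    · rfl
  have hE : ∑ σ ∈ Finset.univ.filter (fun σ : Finset (Fin n) => σ.card = e), E σ
      = 2 * e * Q := by
    simp only [E, Q]
    rw [reindex K (fun σ a b => (gSg σ a * F (insert a σ) - gSg σ b * F (insert b σ)) ^ 2),
      Finset.mul_sum]
    refine Finset.sum_congr rfl fun ρ hρ => ?_
    have hρK : ρ ∈ K := (Finset.mem_filter.mp hρ).1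
    have hρc : ρ.card = e + 2 := (Finset.mem_filter.mp hρ).2
    let C : Fin n → ℝ := fun a => gSg (ρ.erase a) a * F (ρ.erase a)
    have hC0 : ∑ a ∈ ρ, C a = 0 := hco ρ hρK hρc
    have hC2 : ∀ a, C a ^ 2 = F (ρ.erase a) ^ 2 := by
      intro a
      simp only [C]
      rw [mul_pow, sq (gSg _ _), gSg_sq, one_mul]
    have : 2 * e * (∑ b ∈ ρ, F (ρ.erase b) ^ 2) =
        ∑ a ∈ ρ, ∑ b ∈ ρ, (C a + C b) ^ 2 - ∑ a ∈ ρ, (C a + C a) ^ 2 := by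
      simp only [← hC2]
      have h1 : ∀ a b, (C a + C b) ^ 2 = C a ^ 2 + C b ^ 2 + 2 * C a * C b := by
        intros; ring
      have h2 : ∀ a, (C a + C a) ^ 2 = 4 * C a ^ 2 := by intros; ring
      simp only [h2]
      simp only [h1, Finset.sum_add_distrib, ← Finset.mul_sum, hC0, Finset.sum_const, hρc]
      simp only [← Finset.mul_sum, nsmul_eq_mul]
      push_cast
      simp
      ring
    rw [this, ← offdiag_sum ρ (fun a b => (C a + C b) ^ 2)]
    refine Finset.sum_congr rfl fun a _ => Finset.sum_congr rfl fun b _ => ?_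
    split_ifs with h
    · obtain ⟨ha, hb, hab⟩ := h
      set σ := (ρ.erase a).erase b with hσ
      have e1 : insert b σ = ρ.erase a := by
        rw [hσ, Finset.insert_erase (by simp [hb, hab.symm])]
      have e2 : insert a σ = ρ.erase b := by
        rw [hσ, Finset.erase_right_comm, Finset.insert_erase (by simp [ha, hab])]
      have has : a ∉ σ := by simp [hσ]
      have hbs : b ∉ σ := by simp [hσ]
      have hanti := gSg_anti σ a b hab has hbs
      simp only [C]
      rw [← e1, ← e2]
      have p2 := gSg_sq σ a
      have q2 := gSg_sq σ b
      have r2 := gSg_sq (insert a σ) b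
      have t2 := gSg_sq (insert b σ) a
      generalize gSg σ a = p at *
      generalize gSg σ b = q at *
      generalize gSg (insert a σ) b = r at *
      generalize gSg (insert b σ) a = t at *
      generalize F (insert a σ) = A
      generalize F (insert b σ) = B
      have hpq : p * q = - (t * r) := by
        calc p * q = (p * r) * (q * r) := by linear_combination (-(p * q)) * r2
          _ = - (q * t) * (q * r) := by rw [hanti]
          _ = - (t * r) := by linear_combination (-(t * r)) * q2
      linear_combination A ^ 2 * p2 + B ^ 2 * q2 - A ^ 2 * r2 - B ^ 2 * t2 - 2 * A * B * hpq
    · rfl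
  by_contra hF
  have hne : τ.Nonempty := Finset.card_pos.mp (by omega)
  obtain ⟨v, hv⟩ := hne
  have hσc : (τ.erase v).card = e := by rw [Finset.card_erase_of_mem hv, hτc]; rfl
  have hσK : τ.erase v ∈ K :=
    hcplx _ hτ _ (Finset.erase_subset _ _) (Finset.card_pos.mp (by omega))
  have hlt : ∑ σ ∈ Finset.univ.filter (fun σ : Finset (Fin n) => σ.card = e), 2 * c * N σ
      < ∑ σ ∈ Finset.univ.filter (fun σ : Finset (Fin n) => σ.card = e), E σ := by
    refine Finset.sum_lt_sum hle ⟨τ.erase v, by simp [hσc], ?_⟩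
    refine hstrict _ hσK hσc ⟨v, by simp, by rwa [Finset.insert_erase hv], ?_⟩
    rw [Finset.insert_erase hv]
    refine mul_ne_zero (fun h => ?_) hF
    have := gSg_sq (τ.erase v) v
    rw [h] at this
    simp at this
  rw [← Finset.mul_sum, hN, hE] at hlt
  have hce : c * (e + 1) = e := by
    rw [hc]; push_cast; field_simp; ring
  have : 2 * c * ((e + 1) * Q) = 2 * e * Q := by
    linear_combination 2 * Q * hce
  linarith

/-- **Garland's theorem** (Ballmann–Świątkowski refinement). If `Δ` is a finite,
pure `d`-dimensional simplicial complex such that the link of every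
`(d−2)`-dimensional face is a connected graph on at least two vertices whose
normalized Laplacian spectral gap satisfies `λ₂ > 1 − 1/d`, then
`H_{d−1}(Δ, ℝ) = 0`. (For a connected graph, `λ₂ > a` is expressed by: every
eigenvalue of the normalized Laplacian is `0` or `> a`.) -/
theorem garland (n d : ℕ) (hd : 2 ≤ d) (K : Finset (Finset (Fin n)))
    (hcplx : ∀ s ∈ K, ∀ t ⊆ s, t.Nonempty → t ∈ K)
    (hdim : ∀ s ∈ K, s.card ≤ d + 1)
    (hpure : ∀ s ∈ K, ∃ t ∈ K, s ⊆ t ∧ t.card = d + 1)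
    (hlink : ∀ σ ∈ K, σ.card = d - 1 →
      (linkGraph K σ).Connected ∧
      2 ≤ Fintype.card {v : Fin n // {v} ∈ linkSet K σ} ∧
      ∀ μ : ℝ, (∃ x : {v : Fin n // {v} ∈ linkSet K σ} → ℝ, x ≠ 0 ∧
          (normalizedLaplacian (linkGraph K σ)).mulVec x = μ • x) →
        μ = 0 ∨ 1 - 1 / (d : ℝ) < μ) :
    HomologyZero K (d - 1) ℝ := by
  obtain ⟨e, rfl⟩ : ∃ e, d = e + 1 := ⟨d - 1, by omega⟩
  simp only [Nat.add_sub_cancel] at hlink ⊢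
  intro f hf
  have hw : ∀ τ : {s : Finset (Fin n) // s ∈ K ∧ s.card = e + 1}, 0 < gW K τ.1 := by
    intro τ
    obtain ⟨t, ht, hsub, htc⟩ := hpure τ.1 τ.2.1
    have hlt : τ.1.card < t.card := by rw [htc, τ.2.2]; omega
    obtain ⟨b, hb, hbτ⟩ := Finset.exists_mem_notMem_of_card_lt_card hlt
    refine Finset.sum_pos' (fun b _ => by split_ifs <;> norm_num) ⟨b, Finset.mem_univ _, ?_⟩
    rw [if_pos]
    · norm_num
    · exact ⟨hbτ, hcplx t ht _ (Finset.insert_subset hb hsub) (Finset.insert_nonempty _ _)⟩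
  obtain ⟨g, hg⟩ := weighted_proj (chainBoundaryLin K (e + 1)) (fun τ => gW K τ.1) hw f
  refine ⟨g, ?_⟩
  let φ : Chains K (e + 1) ℝ := fun τ => (f τ - chainBoundaryLin K (e + 1) g τ) / gW K τ.1
  have hz : ∀ τ ∈ K, τ.card = e + 1 → gExt φ τ = 0 := by
    intro τ hτ hτc
    refine gHarmonic_zero (by omega) K hcplx hlink (gExt φ) ?_ ?_ τ hτ hτc
    · exact fun ρ hρ hc => cocycle_eq hcplx φ hg ρ hρ hc
    · intro σ hσ hσc
      have h1 : chainBoundaryLin K e (f - chainBoundaryLin K (e + 1) g) ⟨σ, hσ, hσc⟩ = 0 := by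
        rw [map_sub]
        have h2 : chainBoundaryLin K e f = 0 := hf
        have h3 : chainBoundaryLin K e (chainBoundaryLin K (e + 1) g) = 0 := bd_bd hcplx g
        rw [h2, h3]; simp
      have h4 := bd_eq (f - chainBoundaryLin K (e + 1) g) ⟨σ, hσ, hσc⟩
      refine Eq.trans ?_ (h4.symm.trans h1)
      refine Finset.sum_congr rfl fun v _ => ?_
      by_cases hv : v ∈ σ
      · simp [hv]
      · by_cases hvK : insert v σ ∈ K
        · have hh : insert v σ ∈ K ∧ (insert v σ).card = e + 1 :=
            ⟨hvK, by rw [Finset.card_insert_of_notMem hv, hσc]⟩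
          have := hw ⟨_, hh⟩
          rw [if_pos ⟨hv, hvK⟩, if_pos hv, gExt, dif_pos hh, gExt, dif_pos hh]
          simp only [φ, Pi.sub_apply]
          field_simp
        · rw [if_neg (fun h => hvK h.2), if_pos hv, gExt, dif_neg (fun h => hvK h.1), mul_zero]
  funext τ
  have h1 := hz τ.1 τ.2.1 τ.2.2
  rw [gExt, dif_pos τ.2] at h1
  have h2 := hw τ
  simp only [φ] at h1
  have h3 := (div_eq_zero_iff.mp h1).resolve_right h2.ne'
  exact (sub_eq_zero.mp h3).symm
end
end

section
/- Fix d ≥ 1, let ω: ℕ → ℝ be any function with ω(n) → ∞, and let Y = Y_d(n,p). If p ≥ (d log n + ω(n))/n, then w.h.p. H_{d−1}(Y, ℝ) = 0 (reduced homology when d = 1); and if p ≤ (d log n − ω(n))/n, then w.h.p. H_{d−1}(Y, ℝ) ≠ 0. -/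
open MeasureTheory Filter Finset Matrix

noncomputable section
namespace HV
set_option linter.all false

variable {V : Type} [Fintype V] [DecidableEq V]

def dl (a : Finset V → ZMod 2) (τ : Finset V) : ZMod 2 := ∑ u ∈ τ, a (τ.erase u)

def ind (A : Finset (Finset V)) (σ : Finset V) : ZMod 2 := if σ ∈ A then 1 else 0

def cobd (d : ℕ) (A : Finset (Finset V)) : Finset (Finset V) :=
  (powersetCard (d+1) univ).filter fun τ => dl (ind A) τ ≠ 0

lemma dl_dl (a : Finset V → ZMod 2) (ρ : Finset V) : dl (dl a) ρ = 0 := by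
  unfold dl
  rw [Finset.sum_sigma']
  refine Finset.sum_involution (fun x _ => ⟨x.2, x.1⟩) ?_ ?_ ?_ ?_
  · rintro ⟨w, u⟩ h
    simp only
    rw [Finset.erase_right_comm]
    exact CharTwo.add_self_eq_zero _
  · rintro ⟨w, u⟩ h _ he
    simp only [mem_sigma, mem_erase] at h
    simp only [Sigma.mk.injEq] at he
    exact h.2.1 he.1
  · rintro ⟨w, u⟩ h
    simp only [mem_sigma, mem_erase] at h ⊢
    exact ⟨h.2.2, fun e => h.2.1 e.symm, h.1⟩
  · rintro ⟨w, u⟩ h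
    rfl

def Av (d : ℕ) (A : Finset (Finset V)) (v : V) : Finset (Finset V) :=
  (powersetCard d univ).filter fun σ => v ∉ σ ∧ insert v σ ∈ cobd d A

lemma cobd_Av (d : ℕ) (A : Finset (Finset V)) (v : V) : cobd d (Av d A v) = cobd d A := by
  ext τ
  simp only [cobd, mem_filter, mem_powersetCard, subset_univ, true_and]
  refine and_congr_right fun hτ => ?_
  have key : ∀ σ : Finset V, σ.card = d → v ∉ σ →
      ind (Av d A v) σ = dl (ind A) (insert v σ) := by
    intro σ h1 h2
    have h3 : (insert v σ).card = d + 1 := by rw [card_insert_of_notMem h2, h1]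
    have h01 : ∀ z : ZMod 2, z ≠ 0 → z = 1 := by decide
    by_cases h : dl (ind A) (insert v σ) = 0
    · simp [ind, Av, cobd, h1, h2, h]
    · rw [h01 _ h]
      simp [ind, Av, cobd, h1, h2, h3, h]
  have key2 : ∀ σ : Finset V, v ∈ σ → ind (Av d A v) σ = 0 := by
    intro σ h
    simp [ind, Av, h]
  suffices h : dl (ind (Av d A v)) τ = dl (ind A) τ by rw [h]
  by_cases hv : v ∈ τ
  · conv_lhs => unfold dl
    rw [Finset.sum_eq_single v]
    · rw [key _ (by rw [card_erase_of_mem hv, hτ]; rfl) (notMem_erase _ _), insert_erase hv]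
    · intro u hu huv
      exact key2 _ (mem_erase.2 ⟨huv.symm, hv⟩)
    · intro h; exact absurd hv h
  · have h := dl_dl (ind A) (insert v τ)
    conv_lhs at h => unfold dl
    rw [Finset.sum_insert hv, erase_insert hv] at h
    have e : dl (ind (Av d A v)) τ = ∑ x ∈ τ, dl (ind A) ((insert v τ).erase x) := by
      conv_lhs => unfold dl
      refine Finset.sum_congr rfl fun u hu => ?_
      rw [key _ (by rw [card_erase_of_mem hu, hτ]; rfl) (fun h => hv (mem_of_mem_erase h))]
      congr 1
      rw [erase_insert_of_ne]
      rintro rfl; exact hv hu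
    rw [e]
    have : ∀ a b : ZMod 2, a + b = 0 → b = a := by decide
    exact this _ _ h

lemma sum_Av (d : ℕ) (A : Finset (Finset V)) :
    ∑ v, (Av d A v).card = (d+1) * (cobd d A).card := by
  have h1 : ∀ v, (Av d A v).card = ((cobd d A).filter (fun τ => v ∈ τ)).card := by
    intro v
    refine Finset.card_bij (fun σ _ => insert v σ) ?_ ?_ ?_
    · intro σ h
      simp only [Av, mem_filter] at h
      simp only [mem_filter]
      exact ⟨h.2.2, mem_insert_self _ _⟩
    · intro σ h σ' h' e
      simp only [Av, mem_filter] at h h'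
      have := congrArg (fun s => s.erase v) e
      simpa [erase_insert h.2.1, erase_insert h'.2.1] using this
    · intro τ h
      simp only [mem_filter] at h
      refine ⟨τ.erase v, ?_, insert_erase h.2⟩
      have h2 := h.1
      simp only [cobd, mem_filter, mem_powersetCard] at h2
      simp only [Av, mem_filter, mem_powersetCard]
      refine ⟨⟨subset_univ _, by rw [card_erase_of_mem h.2, h2.1.2]; rfl⟩, notMem_erase _ _, ?_⟩
      rw [insert_erase h.2]; exact h.1
  simp_rw [h1]
  simp_rw [Finset.card_filter]
  rw [Finset.sum_comm]
  have : ∀ τ ∈ cobd d A, (∑ v, if v ∈ τ then 1 else 0) = d + 1 := by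
    intro τ h
    simp only [cobd, mem_filter, mem_powersetCard] at h
    simp [h.1.2]
  rw [Finset.sum_congr rfl this]
  simp [mul_comm]

lemma mem_cobd_of_unique {d : ℕ} {A : Finset (Finset V)}
    {σ : Finset V} (hσ : σ ∈ A) (hc : σ.card = d) {v : V} (hv : v ∉ σ)
    (h : ∀ σ' ∈ A, σ' ⊆ insert v σ → σ' = σ) : insert v σ ∈ cobd d A := by
  simp only [cobd, mem_filter, mem_powersetCard, subset_univ, true_and]
  refine ⟨by rw [card_insert_of_notMem hv, hc], ?_⟩
  unfold dl
  rw [Finset.sum_eq_single v]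
  · rw [erase_insert hv]; simp [ind, hσ]
  · intro u hu huv
    unfold ind
    rw [if_neg]
    intro hA
    have := h _ hA (erase_subset _ _)
    have h2 : v ∈ (insert v σ).erase u := mem_erase.2 ⟨huv.symm, mem_insert_self _ _⟩
    rw [this] at h2; exact hv h2
  · intro h; exact absurd (mem_insert_self _ _) h

lemma exists_good (d : ℕ) (A : Finset (Finset V)) (hA : A ⊆ powersetCard d univ)
    (hne : A.Nonempty) (v0 : V) (h0 : ∀ σ ∈ A, v0 ∉ σ) :
    ∃ A' ⊆ powersetCard d univ, A'.Nonempty ∧ cobd d A' = cobd d A ∧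
      Fintype.card V * A'.card ≤ (d+1) * (cobd d A').card := by
  have : ∃ v ∈ (univ : Finset V), Fintype.card V * (Av d A v).card ≤ (d+1) * (cobd d A).card := by
    rw [← sum_Av]
    obtain ⟨v, _, hv⟩ := Finset.exists_min_image (univ : Finset V) (fun v => (Av d A v).card)
      ⟨v0, mem_univ _⟩
    refine ⟨v, mem_univ _, ?_⟩
    have := Finset.card_nsmul_le_sum univ (fun v => (Av d A v).card) _ hv
    simpa using this
  obtain ⟨v, -, hv⟩ := this
  refine ⟨Av d A v, filter_subset _ _, ?_, cobd_Av d A v, ?_⟩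
  · rw [Finset.nonempty_iff_ne_empty]
    intro he
    have h1 := cobd_Av d A v
    rw [he] at h1
    obtain ⟨σ, hσ⟩ := hne
    have h2 := mem_cobd_of_unique (d := d) hσ (mem_powersetCard.1 (hA hσ)).2 (h0 σ hσ) (by
      intro σ' h' hs
      have : σ' ⊆ σ := by
        intro x hx
        rcases mem_insert.1 (hs hx) with rfl | h
        · exact absurd hx (h0 _ h')
        · exact h
      exact eq_of_subset_of_card_le this
        (by rw [(mem_powersetCard.1 (hA hσ)).2, (mem_powersetCard.1 (hA h')).2]))
    rw [← h1] at h2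
    simp [cobd, dl, ind] at h2
  · rw [cobd_Av]; exact hv

def adj (d : ℕ) (σ σ' : Finset V) : Prop := σ ≠ σ' ∧ (σ ∪ σ').card = d + 1

instance (d : ℕ) (σ σ' : Finset V) : Decidable (adj d σ σ') := by unfold adj; infer_instance

lemma adj_symm {d : ℕ} {σ σ' : Finset V} (h : adj d σ σ') : adj d σ' σ :=
  ⟨h.1.symm, by rw [union_comm]; exact h.2⟩

lemma cobd_lower (d : ℕ) (A U : Finset (Finset V)) (hA : A ⊆ powersetCard d univ) (hU : U ⊆ A) :
    U.card * (Fintype.card V - d) ≤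
      (cobd d A).card + ((U ×ˢ A).filter fun x => adj d x.1 x.2).card := by
  classical
  let P : Finset (Σ _ : Finset V, V) := U.sigma fun σ => univ \ σ
  have hP : P.card = U.card * (Fintype.card V - d) := by
    rw [Finset.card_sigma, Finset.sum_const_nat]
    intro σ hσ
    rw [card_univ_sdiff, (mem_powersetCard.1 (hA (hU hσ))).2]
  rw [← hP, ← Finset.card_filter_add_card_filter_not
    (fun x => ∀ σ' ∈ A, σ' ⊆ insert x.2 x.1 → σ' = x.1)]
  refine add_le_add ?_ ?_
  · refine Finset.card_le_card_of_injOn (fun x => insert x.2 x.1) ?_ ?_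
    · rintro ⟨σ, v⟩ h
      simp only [P, coe_filter, mem_sigma, Finset.mem_sdiff, mem_univ, true_and, Set.mem_ofPred_eq] at h
      exact mem_cobd_of_unique (hU h.1.1) (mem_powersetCard.1 (hA (hU h.1.1))).2 h.1.2 h.2
    · rintro ⟨σ, v⟩ h ⟨σ', v'⟩ h' e
      simp only [P, coe_filter, mem_sigma, Finset.mem_sdiff, mem_univ, true_and, Set.mem_ofPred_eq] at h h'
      simp only at e
      have h1 : σ' = σ := h.2 σ' (hU h'.1.1) (by rw [e]; exact subset_insert _ _)
      subst h1
      have : v ∈ insert v' σ' := by rw [← e]; exact mem_insert_self _ _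
      rcases mem_insert.1 this with rfl | h3
      · rfl
      · exact absurd h3 h.1.2
  · have hch : ∀ x : (Σ _ : Finset V, V), ∃ σ', x ∈ P.filter (fun x => ¬ ∀ σ' ∈ A, σ' ⊆ insert x.2 x.1 → σ' = x.1) →
        σ' ∈ A ∧ adj d x.1 σ' ∧ x.1 ∪ σ' = insert x.2 x.1 := by
      intro x
      by_cases hx : x ∈ P.filter (fun x => ¬ ∀ σ' ∈ A, σ' ⊆ insert x.2 x.1 → σ' = x.1)
      · have hx' := hx
        simp only [P, mem_filter, mem_sigma, Finset.mem_sdiff, mem_univ, true_and] at hx'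
        obtain ⟨⟨h1, h2⟩, h3⟩ := hx'
        push Not at h3
        obtain ⟨σ', h4, h5, h6⟩ := h3
        have c1 := (mem_powersetCard.1 (hA (hU h1))).2
        have c2 := (mem_powersetCard.1 (hA h4)).2
        have e : x.1 ∪ σ' = insert x.2 x.1 := by
          refine eq_of_subset_of_card_le (union_subset (subset_insert _ _) h5) ?_
          rw [card_insert_of_notMem h2, c1]
          by_contra hlt
          have h8 : x.1 ∪ σ' = x.1 := (eq_of_subset_of_card_le subset_union_left (by omega)).symm
          have h9 : σ' ⊆ x.1 := by rw [← h8]; exact subset_union_right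
          exact h6 (eq_of_subset_of_card_le h9 (by omega))
        exact ⟨σ', fun _ => ⟨h4, ⟨fun h => h6 h.symm, by rw [e, card_insert_of_notMem h2, c1]⟩, e⟩⟩
      · exact ⟨∅, fun h => absurd h hx⟩
    choose g hg using hch
    refine Finset.card_le_card_of_injOn (fun x => (x.1, g x)) ?_ ?_
    · intro x hx
      have h := hg x hx
      simp only [P, coe_filter, mem_sigma, Set.mem_ofPred_eq] at hx
      simp only [coe_filter, mem_product, Set.mem_ofPred_eq]
      exact ⟨⟨hx.1.1, h.1⟩, h.2.1⟩
    · rintro ⟨σ, v⟩ h ⟨σ', v'⟩ h' e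
      have k := (hg _ h).2.2
      have k' := (hg _ h').2.2
      simp only [Prod.mk.injEq] at e
      obtain ⟨e1, e2⟩ := e
      subst e1
      rw [← e2, k] at k'
      simp only [P, coe_filter, mem_sigma, Finset.mem_sdiff, mem_univ, true_and, Set.mem_ofPred_eq] at h
      have : v ∈ insert v' σ := by simp only at k'; rw [← k']; exact mem_insert_self _ _
      rcases mem_insert.1 this with rfl | h3
      · rfl
      · exact absurd h3 h.1.2

def Nb (d : ℕ) (S : Finset (Finset V)) : Finset (Finset V) :=
  (powersetCard d univ).filter fun σ => ∃ s ∈ S, adj d s σ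

lemma greedy (d : ℕ) (A : Finset (Finset V)) (hA : A ⊆ powersetCard d univ) (t : ℝ) (ht : 0 ≤ t) :
    ∃ S ⊆ A, S.card * t ≤ A.card ∧
      ∀ σ ∈ A, (((A \ Nb d S).filter fun u => adj d σ u).card : ℝ) ≤ t := by
  classical
  obtain ⟨S, hS, hmax⟩ := Finset.exists_max_image
    (A.powerset.filter fun S => (S.card * t : ℝ) ≤ (A ∩ Nb d S).card) (fun S => S.card)
    ⟨∅, by simp⟩
  simp only [mem_filter, mem_powerset] at hS hmax
  refine ⟨S, hS.1, hS.2.trans (by exact_mod_cast card_le_card inter_subset_left), ?_⟩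
  intro σ hσ
  by_contra hlt
  push Not at hlt
  have hσS : σ ∉ S := by
    intro h
    have : ((A \ Nb d S).filter fun u => adj d σ u) = ∅ := by
      rw [Finset.filter_eq_empty_iff]
      intro u hu hau
      rw [Finset.mem_sdiff] at hu
      exact hu.2 (mem_filter.2 ⟨hA hu.1, σ, h, hau⟩)
    rw [this] at hlt
    simp at hlt; linarith
  have := hmax (insert σ S) ⟨insert_subset hσ hS.1, ?_⟩
  · rw [card_insert_of_notMem hσS] at this; omega
  · rw [card_insert_of_notMem hσS]
    have h1 : (A ∩ Nb d S) ∪ ((A \ Nb d S).filter fun u => adj d σ u) ⊆ A ∩ Nb d (insert σ S) := by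
      intro u hu
      rcases mem_union.1 hu with h | h
      · rw [mem_inter] at h ⊢
        refine ⟨h.1, ?_⟩
        have h2 := h.2
        simp only [Nb, mem_filter] at h2 ⊢
        obtain ⟨h3, s, hs, h4⟩ := h2
        exact ⟨h3, s, mem_insert_of_mem hs, h4⟩
      · rw [mem_filter, Finset.mem_sdiff] at h
        rw [mem_inter]
        exact ⟨h.1.1, mem_filter.2 ⟨hA h.1.1, σ, mem_insert_self _ _, h.2⟩⟩
    have h2 := card_le_card h1
    rw [card_union_of_disjoint] at h2
    · have h3 : ((A ∩ Nb d S).card : ℝ) + ((A \ Nb d S).filter fun u => adj d σ u).card ≤ (A ∩ Nb d (insert σ S)).card := by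
        exact_mod_cast h2
      push_cast
      linarith [hS.2]
    · rw [Finset.disjoint_left]
      intro u hu hu'
      rw [mem_filter, Finset.mem_sdiff] at hu'
      exact hu'.1.2 (mem_inter.1 hu).2

lemma card_Nb (d : ℕ) (S : Finset (Finset V)) (hS : S ⊆ powersetCard d univ) :
    (Nb d S).card ≤ S.card * (d * Fintype.card V) := by
  classical
  have : Nb d S ⊆ S.biUnion fun s => (s ×ˢ (univ : Finset V)).image fun x => insert x.2 (s.erase x.1) := by
    intro σ hσ
    simp only [Nb, mem_filter, mem_powersetCard] at hσ
    obtain ⟨⟨-, hc⟩, s, hs, hne, hun⟩ := hσ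
    have hcs := (mem_powersetCard.1 (hS hs)).2
    have h1 : (σ \ s).card = 1 := by
      have := card_sdiff_add_card σ s
      rw [union_comm] at this; omega
    have h2 : (s \ σ).card = 1 := by
      have := card_sdiff_add_card s σ
      omega
    obtain ⟨v, hv⟩ := card_eq_one.1 h1
    obtain ⟨u, hu⟩ := card_eq_one.1 h2
    simp only [mem_biUnion, mem_image, mem_product, mem_univ, and_true]
    refine ⟨s, hs, (u, v), ?_, ?_⟩
    · have : u ∈ s \ σ := by rw [hu]; simp
      exact (Finset.mem_sdiff.1 this).1
    · ext x
      have e1 : x ∈ σ \ s ↔ x = v := by rw [hv]; simp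
      have e2 : x ∈ s \ σ ↔ x = u := by rw [hu]; simp
      simp only [Finset.mem_sdiff] at e1 e2
      simp only [mem_insert, mem_erase]
      rw [← e1, ne_eq, ← e2]; tauto
  refine (card_le_card this).trans (card_biUnion_le_card_mul _ _ _ ?_)
  intro s hs
  refine card_image_le.trans ?_
  rw [card_product, (mem_powersetCard.1 (hS hs)).2, card_univ]

lemma card_small {α : Type*} [DecidableEq α] (F : Finset α) (s0 : ℕ) :
    (F.powerset.filter fun S => S.card ≤ s0).card ≤ (F.card + 1) ^ s0 := by
  have : F.powerset.filter (fun S => S.card ≤ s0) ⊆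
      (range (s0+1)).biUnion fun s => powersetCard s F := by
    intro S hS
    simp only [mem_filter, mem_powerset] at hS
    simp only [mem_biUnion, mem_range, mem_powersetCard]
    exact ⟨S.card, by omega, hS.1, rfl⟩
  refine (card_le_card this).trans (card_biUnion_le.trans ?_)
  rw [add_pow]
  refine sum_le_sum fun s hs => ?_
  rw [card_powersetCard, one_pow, mul_one]
  rw [mem_range] at hs
  have h1 : 0 < s0.choose s := Nat.choose_pos (by omega)
  have h2 := Nat.choose_le_pow F.card s
  nlinarith [Nat.zero_le (F.card ^ s)]

end HV
end


noncomputable section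
namespace HV
set_option linter.all false
variable {V : Type} [Fintype V] [DecidableEq V]

def Good (V : Type) [Fintype V] [DecidableEq V] (d m : ℕ) : Finset (Finset (Finset V)) :=
  (powersetCard m (powersetCard d univ)).filter
    fun A => Fintype.card V * m ≤ (d+1) * (cobd d A).card

lemma count_L (d s0 L : ℕ) :
    ((powersetCard d (univ : Finset V)).powerset.filter fun A =>
      ∃ S ⊆ A, S.card ≤ s0 ∧ (A \ Nb d S).card = L).card
      ≤ ((Fintype.card V).choose d + 1) ^ s0 * (2 ^ (s0 * (d * Fintype.card V)) *
        ((Fintype.card V).choose d).choose L) := by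
  classical
  set F := powersetCard d (univ : Finset V) with hF
  have hFc : F.card = (Fintype.card V).choose d := by rw [hF, card_powersetCard, card_univ]
  have hsub : (F.powerset.filter fun A => ∃ S ⊆ A, S.card ≤ s0 ∧ (A \ Nb d S).card = L) ⊆
      (F.powerset.filter fun S => S.card ≤ s0).biUnion fun S =>
        ((Nb d S).powerset ×ˢ powersetCard L F).image fun x => x.1 ∪ x.2 := by
    intro A hA
    simp only [mem_filter, mem_powerset] at hA
    obtain ⟨hAF, S, hSA, hS, hL⟩ := hA
    simp only [mem_biUnion, mem_filter, mem_powerset, mem_image, mem_product, mem_powersetCard]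
    refine ⟨S, ⟨hSA.trans hAF, hS⟩, (A ∩ Nb d S, A \ Nb d S),
      ⟨inter_subset_right, sdiff_subset.trans hAF, hL⟩, ?_⟩
    ext x; simp only [mem_union, mem_inter, Finset.mem_sdiff]; tauto
  refine (card_le_card hsub).trans ((card_biUnion_le_card_mul _ _
    (2 ^ (s0 * (d * Fintype.card V)) * ((Fintype.card V).choose d).choose L) ?_).trans ?_)
  · intro S hS
    simp only [mem_filter, mem_powerset] at hS
    refine card_image_le.trans ?_
    rw [card_product, card_powerset, card_powersetCard, hFc]
    refine Nat.mul_le_mul_right _ (Nat.pow_le_pow_right (by norm_num) ?_)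
    exact (card_Nb d S hS.1).trans (Nat.mul_le_mul_right _ hS.2)
  · refine Nat.mul_le_mul_right _ ?_
    rw [← hFc]
    exact card_small F s0

lemma exists_S (d m s0 : ℕ) (t : ℝ) (ht : 0 ≤ t) (hs : ∀ s : ℕ, (s : ℝ) * t ≤ m → s ≤ s0)
    (A : Finset (Finset V)) (hA : A ⊆ powersetCard d univ) (hm : A.card = m) :
    ∃ S ⊆ A, S.card ≤ s0 ∧ (A \ Nb d S).card ≤ m ∧
      ((A \ Nb d S).card : ℝ) * ((Fintype.card V : ℝ) - d) ≤ (cobd d A).card + m * t := by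
  classical
  obtain ⟨S, hSA, hSt, hS⟩ := greedy d A hA t ht
  refine ⟨S, hSA, hs _ (by rw [← hm]; exact hSt), by rw [← hm]; exact card_le_card sdiff_subset, ?_⟩
  set U := A \ Nb d S
  have h1 := cobd_lower d A U hA sdiff_subset
  have h2 : (((U ×ˢ A).filter fun x => adj d x.1 x.2).card : ℝ) ≤ m * t := by
    have e : ((U ×ˢ A).filter fun x => adj d x.1 x.2).card =
        ∑ σ ∈ A, (U.filter fun u => adj d σ u).card := by
      rw [Finset.card_filter, Finset.sum_product_right]
      refine Finset.sum_congr rfl fun σ hσ => ?_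
      rw [Finset.card_filter]
      refine Finset.sum_congr rfl fun u hu => ?_
      have : adj d u σ ↔ adj d σ u := ⟨adj_symm, adj_symm⟩
      simp only [this]
    rw [e]; push_cast
    refine (Finset.sum_le_card_nsmul _ _ _ hS).trans ?_
    rw [hm, nsmul_eq_mul]
  have h3 : ((U.card * (Fintype.card V - d) : ℕ) : ℝ) ≤
      (cobd d A).card + ((U ×ˢ A).filter fun x => adj d x.1 x.2).card := by exact_mod_cast h1
  rw [Nat.cast_mul] at h3
  have h4 : (Fintype.card V : ℝ) - d ≤ ((Fintype.card V - d : ℕ) : ℝ) := by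
    rw [sub_le_iff_le_add]; exact_mod_cast (by omega)
  have h5 : (0:ℝ) ≤ U.card := by positivity
  nlinarith [mul_le_mul_of_nonneg_left h4 h5]

lemma sum_Good_large (d m s0 : ℕ) (t x : ℝ) (ht : 0 ≤ t) (hs : ∀ s : ℕ, (s : ℝ) * t ≤ m → s ≤ s0)
    (B : ℕ → ℝ) 
    (hB : ∀ b L : ℕ, L ≤ m → (Fintype.card V : ℝ) * m ≤ (d+1) * b →
      (L : ℝ) * ((Fintype.card V : ℝ) - d) ≤ b + m * t → x ^ b ≤ B L) (hB0 : ∀ L, 0 ≤ B L) :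
    ∑ A ∈ Good V d m, x ^ (cobd d A).card ≤
      ∑ L ∈ range (m+1), (((Fintype.card V).choose d + 1) ^ s0 *
        (2 ^ (s0 * (d * Fintype.card V)) * (((Fintype.card V).choose d).choose L : ℝ))) * B L := by
  classical
  have hch : ∀ A : Finset (Finset V), ∃ L : ℕ, A ∈ Good V d m → L ≤ m ∧
      (∃ S ⊆ A, S.card ≤ s0 ∧ (A \ Nb d S).card = L) ∧ x ^ (cobd d A).card ≤ B L := by
    intro A
    by_cases hA : A ∈ Good V d m
    · have hA' := hA
      simp only [Good, mem_filter, mem_powersetCard] at hA'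
      obtain ⟨S, h1, h2, h3, h4⟩ := exists_S d m s0 t ht hs A (fun σ h => mem_powersetCard.2 (mem_powersetCard.1 (hA'.1.1 h))) hA'.1.2
      exact ⟨_, fun _ => ⟨h3, ⟨S, h1, h2, rfl⟩, hB _ _ h3 (by exact_mod_cast hA'.2) h4⟩⟩
    · exact ⟨0, fun h => absurd h hA⟩
  choose g hg using hch
  rw [← Finset.sum_fiberwise_of_maps_to (s := Good V d m) (t := range (m+1)) (g := g)
    (fun A hA => mem_range.2 (by have := (hg A hA).1; omega))]
  refine Finset.sum_le_sum fun L _ => ?_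
  refine (Finset.sum_le_card_nsmul _ _ (B L) ?_).trans ?_
  · intro A hA
    rw [mem_filter] at hA
    have := (hg A hA.1).2.2
    rwa [hA.2] at this
  · rw [nsmul_eq_mul]
    refine mul_le_mul_of_nonneg_right ?_ (hB0 L)
    have := count_L (V := V) d s0 L
    refine le_trans ?_ (b := (((((Fintype.card V).choose d + 1) ^ s0 * (2 ^ (s0 * (d * Fintype.card V)) *
        ((Fintype.card V).choose d).choose L) : ℕ)) : ℝ)) (le_of_eq (by push_cast; ring))
    refine Nat.cast_le.2 (le_trans (card_le_card ?_) this)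
    intro A hA
    rw [mem_filter] at hA
    have h := (hg A hA.1).2.1
    rw [hA.2] at h
    have h1 := hA.1
    simp only [Good, mem_filter, mem_powersetCard] at h1
    exact mem_filter.2 ⟨mem_powerset.2 (fun σ hσ => mem_powersetCard.2 (mem_powersetCard.1 (h1.1.1 hσ))), h⟩

lemma choose_exp (n d L : ℕ) (hn : 1 ≤ n) :
    ((n.choose d).choose L : ℝ) ≤ Real.exp (d * Real.log n * L) := by
  have h0 : (0:ℝ) < n := by exact_mod_cast hn
  have h : ((n.choose d).choose L : ℝ) ≤ ((n:ℝ) ^ d) ^ L := by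
    exact_mod_cast (Nat.choose_le_pow _ _).trans (Nat.pow_le_pow_left (Nat.choose_le_pow _ _) _)
  refine h.trans (le_of_eq ?_)
  rw [mul_comm (d * Real.log n), Real.exp_nat_mul, Real.exp_nat_mul, Real.exp_log h0]

lemma choose_exp' (n d L : ℕ) (hn : 1 ≤ n) (hL : 1 ≤ L) :
    ((n.choose d).choose L : ℝ) ≤ Real.exp (d * Real.log n * L + L - L * Real.log L) := by
  have h0 : (0:ℝ) < n := by exact_mod_cast hn
  have hL0 : (0:ℝ) < L := by exact_mod_cast hL
  have h1 : ((n.choose d).choose L : ℝ) ≤ ((n.choose d : ℕ) : ℝ) ^ L / (L.factorial : ℝ) :=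
    Nat.choose_le_pow_div _ _
  have h2 : ((n.choose d : ℕ) : ℝ) ^ L ≤ ((n:ℝ) ^ d) ^ L := by
    exact_mod_cast (Nat.pow_le_pow_left (Nat.choose_le_pow n d) L)
  have h3 : (L:ℝ) ^ L / L.factorial ≤ Real.exp L := Real.pow_div_factorial_le_exp (L:ℝ) hL0.le L
  have e : Real.exp (d * Real.log n * L + L - L * Real.log L) =
      ((n:ℝ) ^ d) ^ L * (Real.exp L / (L:ℝ)^L) := by
    rw [add_sub_assoc, Real.exp_add, Real.exp_sub, mul_comm (d * Real.log n), Real.exp_nat_mul,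
      Real.exp_nat_mul, Real.exp_log h0, Real.exp_nat_mul, Real.exp_log hL0]
  rw [e]
  have hf : (0:ℝ) < L.factorial := by exact_mod_cast L.factorial_pos
  have h4 : 1 / (L.factorial : ℝ) ≤ Real.exp L / (L:ℝ)^L := by
    rw [div_le_div_iff₀ hf (by positivity)]
    rw [div_le_iff₀ hf] at h3
    linarith
  calc _ ≤ _ := h1
    _ = ((n.choose d : ℕ) : ℝ) ^ L * (1 / (L.factorial : ℝ)) := by ring
    _ ≤ _ := by gcongr

/-- arithmetic core -/
lemma exp_core (d l n m L b : ℝ) (hd : 1 ≤ d) (hl : 0 ≤ l) (hn : 0 < n) (hm : 0 ≤ m)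
    (hL0 : 0 ≤ L) (hLm : L ≤ m) (h1 : n * m ≤ (d+1) * b) 
    (hdn : d * (16 * d * (d+1)) ≤ n)
    (h2 : L * (n - d) ≤ b + m * (n / (16 * d * (d+1)))) :
    m / (d+1) ≤ b / n ∧ L - m / (8 * d * (d+1)) ≤ b / n := by
  constructor
  · rw [div_le_div_iff₀ (by linarith) hn]; linarith
  · have hK : 0 < 16 * d * (d+1) := by positivity
    rw [le_div_iff₀ hn]
    have e1 : L * d ≤ m * (n / (16 * d * (d+1))) := by
      have : d ≤ n / (16 * d * (d+1)) := by rw [le_div_iff₀ hK]; linarith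
      exact mul_le_mul hLm this (by linarith) hm
    have e2 : m / (8 * d * (d+1)) * n = 2 * (m * (n / (16 * d * (d+1)))) := by
      field_simp; ring
    nlinarith

end HV
end


noncomputable section
namespace HV
set_option linter.all false

lemma term_core (d l n m L s C K : ℝ) (hd : 1 ≤ d) (hl : 0 ≤ l) (hm : 0 ≤ m) 
    (hL0 : 0 ≤ L) (hLm : L ≤ m) (hlog : L ≠ 0 → l / 2 - Real.log (2*(d+1)) ≤ Real.log L ∨ L ≤ m / (2*(d+1)))
    (hl2 : 2 * (1 + Real.log (2*(d+1))) ≤ l) (ch : ℝ) 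
    (h1 : ch ≤ d * l * L) (h2 : L ≠ 0 → ch ≤ d * l * L + L - L * Real.log L) :
    ch - d * l * max (m/(d+1)) (L - m / (8 * d * (d+1))) ≤
      m * (1 + Real.log (2*(d+1)) - l / (8*(d+1))) := by
  have hlp : 0 ≤ Real.log (2*(d+1)) := Real.log_nonneg (by linarith)
  have hdl : 0 ≤ d * l := by positivity
  have hX : 0 ≤ m / (8*(d+1)) := by positivity
  have a1 : m / (d+1) = 8 * (m / (8*(d+1))) := by field_simp
  have a2 : m / (2*(d+1)) = 4 * (m / (8*(d+1))) := by field_simp; ring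
  have a3 : d * (m / (8 * d * (d+1))) = (m / (8*(d+1))) := by field_simp
  have a4 : m * (l / (8*(d+1))) = l * (m / (8*(d+1))) := by field_simp
  by_cases hc : L ≤ m / (2*(d+1))
  · have k1 := mul_le_mul_of_nonneg_left (le_max_left (m/(d+1)) (L - m / (8 * d * (d+1)))) hdl
    have k2 := mul_le_mul_of_nonneg_left hc hdl
    have k3 : 0 ≤ m * (1 + Real.log (2*(d+1))) := by positivity
    rw [mul_sub, a4]
    rw [a1] at k1
    rw [a2] at k2
    have k4 : l * (m / (8*(d+1))) ≤ d * l * (m / (8*(d+1))) := by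
      have : l ≤ d * l := by nlinarith
      exact mul_le_mul_of_nonneg_right this hX
    rw [a1]
    have k5 : 0 ≤ d * l * (m / (8*(d+1))) := by positivity
    linarith
  · push Not at hc
    have hL : L ≠ 0 := by
      intro h; rw [h] at hc
      have : 0 ≤ m / (2*(d+1)) := by positivity
      linarith
    have g1 : l / 2 - Real.log (2*(d+1)) ≤ Real.log L := (hlog hL).resolve_right (not_le.2 hc)
    have g2 := h2 hL
    have k1 := mul_le_mul_of_nonneg_left (le_max_right (m/(d+1)) (L - m / (8 * d * (d+1)))) hdl
    have k2 : d * l * (L - m / (8 * d * (d+1))) = d * l * L - l * (m / (8*(d+1))) := by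
      rw [← a3]; ring
    have k3 : L * (1 - Real.log L) ≤ L * (1 + Real.log (2*(d+1)) - l/2) :=
      mul_le_mul_of_nonneg_left (by linarith) hL0
    have k4 : L * (1 + Real.log (2*(d+1)) - l/2) ≤ m/(2*(d+1)) * (1 + Real.log (2*(d+1)) - l/2) :=
      mul_le_mul_of_nonpos_right hc.le (by linarith)
    have k5 : m/(2*(d+1)) * (1 + Real.log (2*(d+1))) ≤ m * (1 + Real.log (2*(d+1))) := by
      refine mul_le_mul_of_nonneg_right (div_le_self hm (by linarith)) (by linarith)
    rw [mul_sub, a4]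
    rw [mul_sub, a2] at k4
    rw [a2] at k5
    linarith

lemma large_m (d n m : ℕ) (hd : 1 ≤ d) (hn : 2 ≤ n) (hmn : n ≤ m ^ 2)
    (c1 : (d:ℝ) * (16 * d * (d+1)) ≤ n)
    (c2 : 16 * d * (d+1) * ((d+1) * Real.log n) ≤ (n:ℝ))
    (c3 : 2 * (1 + Real.log (2*((d:ℝ)+1))) ≤ Real.log n)
    (x : ℝ) (hx0 : 0 ≤ x) (hx : x ≤ Real.exp (-(d * Real.log n / n))) :
    ∑ A ∈ Good (Fin n) d m, x ^ (cobd d A).card ≤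
      Real.exp ((1 + (1 + d * (16 * d * (d+1))) + (1 + Real.log (2*((d:ℝ)+1)))) - Real.log n / (8*(d+1))) ^ m := by
  have hdR : (1:ℝ) ≤ d := by exact_mod_cast hd
  have hn0 : (0:ℝ) < n := by exact_mod_cast (by omega : 0 < n)
  have hl : 0 ≤ Real.log n := Real.log_nonneg (by exact_mod_cast (by omega : 1 ≤ n))
  set l := Real.log n with hldef
  set K : ℝ := 16 * d * (d+1) with hK
  have hK0 : 0 < K := by positivity
  have hm0 : (0:ℝ) ≤ m := by positivity
  have ht : 0 < (n:ℝ) / K := by positivity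
  set s0 := ⌊(m:ℝ) / ((n:ℝ)/K)⌋₊ with hs0
  have hs0le : (s0:ℝ) ≤ m * K / n := by
    refine (Nat.floor_le (by positivity)).trans (le_of_eq ?_)
    field_simp
  have hmlog : l / 2 ≤ Real.log m := by
    have h1 : (n:ℝ) ≤ (m:ℝ)^2 := by exact_mod_cast hmn
    have h2 := Real.log_le_log hn0 h1
    rw [Real.log_pow] at h2
    push_cast at h2
    linarith
  have hm1 : (0:ℝ) < m := by
    rcases Nat.eq_zero_or_pos m with h | h
    · subst h; simp at hmn; omega
    · exact_mod_cast h
  refine (sum_Good_large (V := Fin n) d m s0 ((n:ℝ)/K) x ht.le ?_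
    (fun L => Real.exp (-(d * l * max ((m:ℝ)/(d+1)) (L - m / (8 * d * (d+1)))))) ?_
    (fun L => (Real.exp_pos _).le)).trans ?_
  · intro s hs
    refine Nat.le_floor ?_
    rwa [le_div_iff₀ ht]
  · intro b L hLm h1 h2
    simp only [Fintype.card_fin] at h1 h2
    obtain ⟨e1, e2⟩ := exp_core d l n m L b hdR hl hn0 hm0 (by positivity) (by exact_mod_cast hLm) h1 c1 h2
    calc x ^ b ≤ Real.exp (-(d * l / n)) ^ b := pow_le_pow_left₀ hx0 hx b
      _ = Real.exp (-(d * l * (b / n))) := by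
        rw [← Real.exp_nat_mul]; congr 1; ring
      _ ≤ _ := by
        refine Real.exp_le_exp.2 (neg_le_neg (mul_le_mul_of_nonneg_left (max_le e1 e2) (by positivity)))
  · simp only [Fintype.card_fin]
    set Z : ℝ := (1 + d * K) + (1 + Real.log (2*((d:ℝ)+1))) - l / (8*(d+1)) with hZ
    have hterm : ∀ L ∈ range (m+1), ((((n.choose d : ℕ):ℝ) + 1) ^ s0 *
        (2 ^ (s0 * (d * n)) * ((n.choose d).choose L : ℝ))) *
          Real.exp (-(d * l * max ((m:ℝ)/(d+1)) (L - m / (8 * d * (d+1))))) ≤ Real.exp (m * Z) := by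
      intro L hL
      rw [mem_range] at hL
      have hLm : (L:ℝ) ≤ m := by exact_mod_cast (by omega : L ≤ m)
      have t1 : (((n.choose d : ℕ):ℝ) + 1) ^ s0 ≤ Real.exp m := by
        have : ((n.choose d : ℕ):ℝ) + 1 ≤ (n:ℝ)^(d+1) := by
          have h1 := Nat.choose_le_pow n d
          have h2 : 1 ≤ n ^ d := Nat.one_le_pow _ _ (by omega)
          have : n.choose d + 1 ≤ n ^ (d+1) := by rw [pow_succ]; nlinarith
          exact_mod_cast this
        calc _ ≤ ((n:ℝ)^(d+1))^s0 := pow_le_pow_left₀ (by positivity) this _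
          _ = Real.exp (s0 * ((d+1) * l)) := by
            rw [Real.exp_nat_mul]; congr 1
            rw [hldef, show ((d:ℝ)+1) = ((d+1 : ℕ) : ℝ) by push_cast; rfl, Real.exp_nat_mul, Real.exp_log hn0]
          _ ≤ _ := by
            refine Real.exp_le_exp.2 ?_
            calc (s0:ℝ) * ((d+1) * l) ≤ m * K / n * ((d+1) * l) := by gcongr
              _ = m * (K * ((d+1) * l) / n) := by ring
              _ ≤ m * 1 := by
                gcongr
                rw [div_le_one hn0]; exact c2
              _ = m := by ring
      have t2 : (2:ℝ) ^ (s0 * (d * n)) ≤ Real.exp (m * (d * K)) := by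
        have h2e : (2:ℝ) ≤ Real.exp 1 := by
          have := Real.add_one_le_exp (1:ℝ); linarith
        calc (2:ℝ) ^ (s0 * (d * n)) ≤ Real.exp 1 ^ (s0 * (d * n)) := pow_le_pow_left₀ (by norm_num) h2e _
          _ = Real.exp (s0 * (d * n)) := by rw [← Real.exp_nat_mul]; push_cast; ring_nf
          _ ≤ _ := by
            refine Real.exp_le_exp.2 ?_
            calc (s0:ℝ) * (d * n) ≤ m * K / n * (d * n) := by gcongr
              _ = _ := by field_simp
      have t3 : ∃ ch : ℝ, ((n.choose d).choose L : ℝ) ≤ Real.exp ch ∧ ch ≤ d * l * L ∧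
          ((L:ℝ) ≠ 0 → ch ≤ d * l * L + L - L * Real.log L) := by
        refine ⟨if L = 0 then d * l * L else min (d * l * L) (d * l * L + L - L * Real.log L), ?_, ?_, ?_⟩
        · split_ifs with h
          · exact choose_exp n d L (by omega)
          · rcases min_choice (d * l * L) (d * l * L + L - L * Real.log L) with h' | h' <;> rw [h']
            · exact choose_exp n d L (by omega)
            · exact choose_exp' n d L (by omega) (by omega)
        · split_ifs
          · exact le_rfl
          · exact min_le_left _ _
        · intro h
          rw [if_neg (by exact_mod_cast h)]
          exact min_le_right _ _
      obtain ⟨ch, ch1, ch2, ch3⟩ := t3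
      have core := term_core d l n m L s0 0 K hdR hl hm0 (by positivity) hLm (by
        intro hL0
        by_cases hc : (L:ℝ) ≤ m / (2*(d+1))
        · exact Or.inr hc
        · left
          push Not at hc
          have h1 := Real.log_le_log (by positivity) hc.le
          rw [Real.log_div hm1.ne' (by positivity)] at h1
          linarith) c3 ch ch2 ch3
      calc _ ≤ (Real.exp m * (Real.exp (m * (d * K)) * Real.exp ch)) *
          Real.exp (-(d * l * max ((m:ℝ)/(d+1)) (L - m / (8 * d * (d+1))))) := by gcongr
        _ = Real.exp (m * (1 + d * K) + (ch - d * l * max ((m:ℝ)/(d+1)) (L - m / (8 * d * (d+1))))) := by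
          rw [← Real.exp_add, ← Real.exp_add, ← Real.exp_add]; congr 1; ring
        _ ≤ _ := by
          refine Real.exp_le_exp.2 ?_
          rw [hZ]
          linarith
    refine (Finset.sum_le_card_nsmul _ _ _ hterm).trans ?_
    rw [card_range, nsmul_eq_mul, ← Real.exp_nat_mul]
    have h1 : ((m + 1 : ℕ) : ℝ) ≤ Real.exp m := by
      push_cast; exact Real.add_one_le_exp _
    calc ((m + 1 : ℕ) : ℝ) * Real.exp (m * Z) ≤ Real.exp m * Real.exp (m * Z) := by gcongr
      _ = _ := by rw [← Real.exp_add]; congr 1; rw [hZ]; ring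

lemma small_m (d n m : ℕ) (hd : 1 ≤ d) (hn : 2 ≤ n) (hmn : m ^ 2 < n)
    (W : ℝ) (hW0 : 0 ≤ W) (hW : W ≤ Real.log n)
    (c4 : ((d:ℝ)+1) * Real.log n * ((d + Real.sqrt n)) ≤ (n:ℝ))
    (x : ℝ) (hx0 : 0 ≤ x) (hx : x ≤ Real.exp (-((d * Real.log n + W) / n))) :
    ∑ A ∈ Good (Fin n) d m, x ^ (cobd d A).card ≤ Real.exp (1 - W) ^ m := by
  have hdR : (1:ℝ) ≤ d := by exact_mod_cast hd
  have hn0 : (0:ℝ) < n := by exact_mod_cast (by omega : 0 < n)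
  have hl : 0 ≤ Real.log n := Real.log_nonneg (by exact_mod_cast (by omega : 1 ≤ n))
  set l := Real.log n with hldef
  have hms : (m:ℝ) ≤ Real.sqrt n := by
    refine Real.le_sqrt_of_sq_le ?_
    exact_mod_cast hmn.le
  have hterm : ∀ A ∈ Good (Fin n) d m, x ^ (cobd d A).card ≤ Real.exp (m * (1 - W - d * l)) := by
    intro A hA
    simp only [Good, mem_filter, mem_powersetCard] at hA
    have hA1 : A ⊆ powersetCard d univ := fun σ h => mem_powersetCard.2 (mem_powersetCard.1 (hA.1.1 h))
    have h1 := cobd_lower d A A hA1 subset_rfl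
    have h2 : ((A ×ˢ A).filter fun x => adj d x.1 x.2).card ≤ m * m := by
      refine (card_filter_le _ _).trans ?_
      rw [card_product, hA.1.2]
    rw [hA.1.2, Fintype.card_fin] at h1
    have h3 : (m:ℝ) * (n - d - m) ≤ (cobd d A).card := by
      have h4 : (n : ℝ) - d ≤ ((n - d : ℕ) : ℝ) := by
        rw [sub_le_iff_le_add]; exact_mod_cast (by omega)
      have h5 : ((m * (n - d) : ℕ) : ℝ) ≤ (cobd d A).card + m * m := by
        exact_mod_cast h1.trans (by omega)
      rw [Nat.cast_mul] at h5
      have h6 : (0:ℝ) ≤ m := by positivity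
      nlinarith [mul_le_mul_of_nonneg_left h4 h6]
    calc x ^ (cobd d A).card ≤ Real.exp (-((d * l + W) / n)) ^ (cobd d A).card := pow_le_pow_left₀ hx0 hx _
      _ = Real.exp (-((d * l + W) / n * (cobd d A).card)) := by
        rw [← Real.exp_nat_mul]; congr 1; ring
      _ ≤ _ := by
        refine Real.exp_le_exp.2 ?_
        have k1 : (d * l + W) / n * (m * (n - d - m)) ≤ (d * l + W) / n * (cobd d A).card := by gcongr
        have k2 : (d * l + W) / n * (m * (n - d - m)) = m * (d * l + W) - m * ((d * l + W) * (d + m) / n) := by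
          field_simp; ring
        have k3 : (d * l + W) * (d + m) / n ≤ 1 := by
          rw [div_le_one hn0]
          refine le_trans ?_ c4
          have : d * l + W ≤ (d+1) * l := by linarith
          gcongr
        have k4 : (m:ℝ) * ((d * l + W) * (d + m) / n) ≤ m * 1 := by gcongr
        linarith
  refine (Finset.sum_le_card_nsmul _ _ _ hterm).trans ?_
  rw [nsmul_eq_mul]
  have hcard : ((Good (Fin n) d m).card : ℝ) ≤ Real.exp (d * l * m) := by
    refine le_trans ?_ (choose_exp n d m (by omega))
    refine Nat.cast_le.2 ((card_filter_le _ _).trans ?_)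
    rw [card_powersetCard, card_powersetCard, card_univ, Fintype.card_fin]
  calc _ ≤ Real.exp (d * l * m) * Real.exp (m * (1 - W - d * l)) := by gcongr
    _ = _ := by rw [← Real.exp_add, ← Real.exp_nat_mul]; congr 1; ring

lemma geom_le (r : ℝ) (h0 : 0 ≤ r) (h : r ≤ 1/2) (M : ℕ) : ∑ m ∈ Icc 1 M, r ^ m ≤ 2 * r := by
  have h1 : ∀ M : ℕ, ∑ m ∈ Icc 1 M, r ^ m ≤ 2 * r - 2 * r ^ (M+1) := by
    intro M
    induction M with
    | zero => simp
    | succ M ih =>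
      rw [Finset.sum_Icc_succ_top (by omega)]
      have : r ^ (M+1+1) ≤ r^(M+1) * (1/2) := by rw [pow_succ]; gcongr
      linarith
  have := h1 M
  have h2 : 0 ≤ r ^ (M+1) := by positivity
  linarith

lemma total (d : ℕ) (hd : 1 ≤ d) (W : ℕ → ℝ) (hW : Tendsto W atTop atTop) (hWl : ∀ᶠ n in atTop, W n ≤ Real.log n) 
    (x : ℕ → ℝ) (hx0 : ∀ n, 0 ≤ x n) (hx : ∀ᶠ n : ℕ in atTop, x n ≤ Real.exp (-((d * Real.log n + W n) / n))) :
    Tendsto (fun n : ℕ => ∑ m ∈ Icc 1 (n.choose d), ∑ A ∈ Good (Fin n) d m, (x n) ^ (cobd d A).card)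
      atTop (nhds 0) := by
  have hdR : (1:ℝ) ≤ d := by exact_mod_cast hd
  set C : ℝ := (1 + (1 + d * (16 * d * (d+1))) + (1 + Real.log (2*((d:ℝ)+1)))) with hC
  have hlog : Tendsto (fun n : ℕ => Real.log n) atTop atTop :=
    Real.tendsto_log_atTop.comp tendsto_natCast_atTop_atTop
  have hln : Tendsto (fun n : ℕ => Real.log n / n) atTop (nhds 0) :=
    (Real.isLittleO_log_id_atTop.tendsto_div_nhds_zero).comp tendsto_natCast_atTop_atTop
  have hlsq : Tendsto (fun n : ℕ => Real.log n / Real.sqrt n) atTop (nhds 0) := by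
    have := ((isLittleO_log_rpow_atTop (r := 1/2) (by norm_num)).tendsto_div_nhds_zero).comp
      (tendsto_natCast_atTop_atTop (R := ℝ))
    refine this.congr fun n => ?_
    simp [Real.sqrt_eq_rpow]
  have r1 : Tendsto (fun n => Real.exp (1 - W n)) atTop (nhds 0) := by
    refine Real.tendsto_exp_atBot.comp ?_
    simp_rw [sub_eq_add_neg]
    exact tendsto_atBot_add_const_left _ _ (tendsto_neg_atTop_atBot.comp hW)
  have r2 : Tendsto (fun n : ℕ => Real.exp (C - Real.log n / (8*(d+1)))) atTop (nhds 0) := by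
    refine Real.tendsto_exp_atBot.comp ?_
    simp_rw [sub_eq_add_neg]
    exact tendsto_atBot_add_const_left _ _ (tendsto_neg_atTop_atBot.comp
      (hlog.atTop_div_const (by positivity)))
  have hb : Tendsto (fun n : ℕ => 2 * Real.exp (1 - W n) + 2 * Real.exp (C - Real.log n / (8*(d+1))))
      atTop (nhds 0) := by
    simpa using (r1.const_mul 2).add (r2.const_mul 2)
  refine squeeze_zero' (Eventually.of_forall fun n => ?_) ?_ hb
  · exact Finset.sum_nonneg fun m _ => Finset.sum_nonneg fun A _ => pow_nonneg (hx0 n) _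
  have e1 : ∀ᶠ n : ℕ in atTop, (d:ℝ) * (16 * d * (d+1)) ≤ n :=
    tendsto_natCast_atTop_atTop.eventually_ge_atTop _
  have e2 : ∀ᶠ n : ℕ in atTop, 16 * d * (d+1) * ((d+1) * Real.log n) ≤ (n:ℝ) := by
    have h := hln.const_mul (16 * (d:ℝ) * (d+1) * (d+1))
    rw [mul_zero] at h
    filter_upwards [h.eventually_le_const (by norm_num : (0:ℝ) < 1), eventually_ge_atTop 1] with n hn h1
    have hn0 : (0:ℝ) < n := by exact_mod_cast h1
    rw [← mul_div_assoc, div_le_one hn0] at hn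
    linarith
  have e3 := hlog.eventually_ge_atTop (2 * (1 + Real.log (2*((d:ℝ)+1))))
  have e4 : ∀ᶠ n : ℕ in atTop, ((d:ℝ)+1) * Real.log n * ((d + Real.sqrt n)) ≤ (n:ℝ) := by
    have h := (hln.const_mul (((d:ℝ)+1)*d)).add (hlsq.const_mul ((d:ℝ)+1))
    rw [mul_zero, mul_zero, add_zero] at h
    filter_upwards [h.eventually_le_const (by norm_num : (0:ℝ) < 1), eventually_ge_atTop 1] with n hn h1
    have hn0 : (0:ℝ) < n := by exact_mod_cast h1
    have hs : 0 < Real.sqrt n := Real.sqrt_pos.2 hn0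
    have hss : Real.sqrt n * Real.sqrt n = n := Real.mul_self_sqrt hn0.le
    have := mul_le_mul_of_nonneg_right hn hn0.le
    have q1 : Real.log n / n * n = Real.log n := by field_simp
    have q2 : Real.log n / Real.sqrt n * n = Real.log n * Real.sqrt n := by
      rw [div_mul_eq_mul_div, div_eq_iff hs.ne', mul_assoc, hss]
    rw [add_mul, mul_assoc _ _ (n:ℝ), q1, mul_assoc _ _ (n:ℝ), q2] at this
    linarith
  filter_upwards [e1, e2, e3, e4, hWl, hx, hW.eventually_ge_atTop 0, eventually_ge_atTop 2,
    r1.eventually_le_const (by norm_num : (0:ℝ) < 1/2), r2.eventually_le_const (by norm_num : (0:ℝ) < 1/2)]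
    with n c1 c2 c3 c4 hWl hx hW0 hn hr1 hr2
  refine le_trans (b := ∑ m ∈ Icc 1 (n.choose d), (Real.exp (1 - W n) ^ m + Real.exp (C - Real.log n / (8*(d+1))) ^ m)) ?_ ?_
  · refine Finset.sum_le_sum fun m _ => ?_
    rcases lt_or_ge (m^2) n with h | h
    · refine (small_m d n m hd hn h (W n) hW0 hWl c4 (x n) (hx0 n) hx).trans ?_
      have : 0 < Real.exp (C - Real.log n / (8*(d+1))) ^ m := by positivity
      linarith
    · refine (large_m d n m hd hn h c1 c2 c3 (x n) (hx0 n) (hx.trans (Real.exp_le_exp.2 ?_))).trans ?_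
      · have hn0 : (0:ℝ) < n := by exact_mod_cast (by omega : 0 < n)
        rw [neg_le_neg_iff]
        gcongr; linarith
      · have : 0 < Real.exp (1 - W n) ^ m := by positivity
        linarith
  · rw [Finset.sum_add_distrib]
    exact add_le_add (geom_le _ (Real.exp_pos _).le hr1 _) (geom_le _ (Real.exp_pos _).le hr2 _)

end HV
end


noncomputable section
namespace HV
set_option linter.all false

def cl (p : ℝ) : ℝ := max 0 (min p 1)
lemma cl_nonneg (p : ℝ) : 0 ≤ cl p := le_max_left _ _
lemma cl_le_one (p : ℝ) : cl p ≤ 1 := max_le zero_le_one (min_le_right _ _)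

instance (p : ℝ) : IsProbabilityMeasure (bernoulliBool p) := by
  constructor
  simp only [bernoulliBool, Measure.add_apply, Measure.smul_apply, smul_eq_mul,
    measure_univ, mul_one]
  change ENNReal.ofReal (cl p) + ENNReal.ofReal (1 - cl p) = 1
  rw [← ENNReal.ofReal_add (cl_nonneg p) (by have := cl_le_one p; linarith)]
  simp

instance (n d : ℕ) (p : ℝ) : IsProbabilityMeasure (YMeasure n d p) := by
  unfold YMeasure; infer_instance

lemma bern_false (p : ℝ) : bernoulliBool p {false} = ENNReal.ofReal (1 - cl p) := by
  simp [bernoulliBool, cl]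

lemma Y_none (n d : ℕ) (p : ℝ) (T : Finset (Finset (Fin n))) (hT : T ⊆ powersetCard (d+1) univ) :
    (YMeasure n d p) {ω | ∀ τ : FaceIdx n d, τ.1 ∈ T → ω τ = false} =
      ENNReal.ofReal ((1 - cl p) ^ T.card) := by
  classical
  have e : {ω : FaceIdx n d → Bool | ∀ τ : FaceIdx n d, τ.1 ∈ T → ω τ = false} =
      Set.pi Set.univ (fun τ : FaceIdx n d => if τ.1 ∈ T then {false} else Set.univ) := by
    ext ω
    simp only [Set.mem_ofPred_eq, Set.mem_pi, Set.mem_univ, true_imp_iff]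
    refine forall_congr' fun τ => ?_
    split_ifs with h <;> simp [h]
  rw [e, YMeasure, Measure.pi_pi]
  have : ∀ τ : FaceIdx n d, bernoulliBool p (if τ.1 ∈ T then {false} else Set.univ) =
      if τ.1 ∈ T then ENNReal.ofReal (1 - cl p) else 1 := by
    intro τ
    split_ifs
    · exact bern_false p
    · exact measure_univ
  simp_rw [this]
  rw [Finset.prod_ite, Finset.prod_const_one, mul_one, Finset.prod_const,
    ENNReal.ofReal_pow (by have := cl_le_one p; linarith)]
  congr 1
  refine Finset.card_bij (fun τ _ => τ.1) ?_ ?_ ?_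
  · intro τ h; exact (mem_filter.1 h).2
  · intro τ _ τ' _ h; exact Subtype.ext h
  · intro t ht
    exact ⟨⟨t, (mem_powersetCard.1 (hT ht)).2⟩, mem_filter.2 ⟨mem_univ _, ht⟩, rfl⟩

/-- Bad event -/
def Bad (n d : ℕ) (v0 : Fin n) : Set (FaceIdx n d → Bool) :=
  {ω | ∃ A : Finset (Finset (Fin n)), A ⊆ powersetCard d univ ∧ A.Nonempty ∧ (∀ σ ∈ A, v0 ∉ σ) ∧
    ∀ τ : FaceIdx n d, τ.1 ∈ cobd d A → ω τ = false}

lemma Bad_le (n d : ℕ) (v0 : Fin n) (p : ℝ) :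
    YMeasure n d p (Bad n d v0) ≤ ENNReal.ofReal
      (∑ m ∈ Icc 1 (n.choose d), ∑ A ∈ Good (Fin n) d m, (1 - cl p) ^ (cobd d A).card) := by
  have hq : 0 ≤ 1 - cl p := by have := cl_le_one p; linarith
  have hsub : Bad n d v0 ⊆ ⋃ m ∈ Icc 1 (n.choose d), ⋃ A ∈ Good (Fin n) d m,
      {ω | ∀ τ : FaceIdx n d, τ.1 ∈ cobd d A → ω τ = false} := by
    rintro ω ⟨A, h1, h2, h3, h4⟩
    obtain ⟨A', g1, g2, g3, g4⟩ := exists_good d A h1 h2 v0 h3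
    simp only [Set.mem_iUnion]
    refine ⟨A'.card, mem_Icc.2 ⟨g2.card_pos, ?_⟩, A', ?_, ?_⟩
    · have := card_le_card g1
      rwa [card_powersetCard, card_univ, Fintype.card_fin] at this
    · exact mem_filter.2 ⟨mem_powersetCard.2 ⟨g1, rfl⟩, g4⟩
    · intro τ hτ; rw [g3] at hτ; exact h4 τ hτ
  refine (measure_mono hsub).trans ((measure_biUnion_finset_le _ _).trans ?_)
  rw [ENNReal.ofReal_sum_of_nonneg (fun m _ => Finset.sum_nonneg fun A _ => pow_nonneg hq _)]
  refine Finset.sum_le_sum fun m _ => ?_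
  refine (measure_biUnion_finset_le _ _).trans ?_
  rw [ENNReal.ofReal_sum_of_nonneg (fun A _ => pow_nonneg hq _)]
  refine Finset.sum_le_sum fun A _ => ?_
  rw [Y_none n d p (cobd d A) (filter_subset _ _)]

lemma cl_exp (p p0 : ℝ) (h0 : 0 ≤ p0) (h : p0 ≤ p) : 1 - cl p ≤ Real.exp (-p0) := by
  unfold cl
  have h1 : 1 - p0 ≤ Real.exp (-p0) := by have := Real.add_one_le_exp (-p0); linarith
  have h2 := Real.exp_pos (-p0)
  rcases le_total p 1 with h3 | h3
  · rw [min_eq_left h3]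
    have := le_max_right 0 p
    linarith
  · rw [min_eq_right h3]
    have := le_max_right 0 (1:ℝ)
    linarith

lemma bad_tendsto (d : ℕ) (hd : 1 ≤ d) (w : ℕ → ℝ) (hw : Tendsto w atTop atTop) (p : ℕ → ℝ)
    (hp : ∀ n : ℕ, (d * Real.log n + w n) / n ≤ p n) :
    Tendsto (fun n : ℕ => ∑ m ∈ Icc 1 (n.choose d), ∑ A ∈ Good (Fin n) d m, (1 - cl (p n)) ^ (cobd d A).card)
      atTop (nhds 0) := by
  have hlog : Tendsto (fun n : ℕ => Real.log n) atTop atTop :=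
    Real.tendsto_log_atTop.comp tendsto_natCast_atTop_atTop
  refine total d hd (fun n => min (w n) (Real.log n)) (by
    rw [tendsto_atTop] at hw hlog ⊢
    intro b
    filter_upwards [hw b, hlog b] with n h1 h2 using le_min h1 h2) ?_ (fun n => 1 - cl (p n)) ?_ ?_
  · exact Eventually.of_forall fun n => min_le_right _ _
  · intro n; have := cl_le_one (p n); linarith
  · filter_upwards [hw.eventually_ge_atTop 0, eventually_ge_atTop 1] with n h0 hn
    have hl : 0 ≤ Real.log n := Real.log_nonneg (by exact_mod_cast hn)
    have hn0 : (0:ℝ) < n := by exact_mod_cast hn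
    refine cl_exp _ _ ?_ (le_trans ?_ (hp n))
    · have : 0 ≤ min (w n) (Real.log n) := le_min h0 hl
      positivity
    · gcongr; exact min_le_left _ _

end HV
end


noncomputable section
namespace HV
set_option linter.all false

section
variable {V : Type} [Fintype V] [DecidableEq V] [LinearOrder V]

def sg (τ : Finset V) (v : V) : ℤ := (-1) ^ (τ.filter (fun u => u < v)).card

lemma sg_pm (τ : Finset V) (v : V) : sg τ v = 1 ∨ sg τ v = -1 := neg_one_pow_eq_or ℤ _

lemma sg_insert (η : Finset V) (u v : V) (hv : v ∉ η) :
    sg (insert v η) u = sg η u * (if v < u then -1 else 1) := by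
  unfold sg
  rw [Finset.filter_insert]
  split_ifs with h
  · rw [card_insert_of_notMem (by simp [hv]), pow_succ]
  · simp

def rb (f : Finset V → ℝ) (τ : Finset V) : ℝ :=
  ∑ v, if v ∉ τ then (sg τ v) • f (insert v τ) else 0

lemma rb_rb (f : Finset V → ℝ) (η : Finset V) : rb (rb f) η = 0 := by
  let T : V → V → ℝ := fun v u => if v ∉ η ∧ u ∉ η ∧ u ≠ v then
    (sg η v * sg (insert v η) u) • f (insert u (insert v η)) else 0
  have h1 : rb (rb f) η = ∑ v, ∑ u, T v u := by
    unfold rb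
    refine Finset.sum_congr rfl fun v _ => ?_
    split_ifs with h
    swap
    · rw [Finset.smul_sum]
      refine Finset.sum_congr rfl fun u _ => ?_
      simp only [T, mem_insert, not_or]
      by_cases h2 : u ∉ η ∧ u ≠ v
      · rw [if_pos ⟨h2.2, h2.1⟩, if_pos ⟨h, h2⟩, smul_smul]
      · rw [if_neg (fun h' => h2 ⟨h'.2, h'.1⟩), if_neg (fun h' => h2 h'.2), smul_zero]
    · symm
      refine Finset.sum_eq_zero fun u _ => ?_
      simp only [T]
      rw [if_neg (fun h' => h'.1 h)]
  have h2 : ∀ v u, T v u = - T u v := by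
    intro v u
    simp only [T]
    by_cases h : v ∉ η ∧ u ∉ η ∧ u ≠ v
    · rw [if_pos h, if_pos ⟨h.2.1, h.1, h.2.2.symm⟩, sg_insert _ _ _ h.1, sg_insert _ _ _ h.2.1,
        Finset.insert_comm, ← neg_smul]
      congr 1
      rcases lt_or_gt_of_ne h.2.2 with h3 | h3
      · rw [if_neg (not_lt.2 h3.le), if_pos h3]; ring
      · rw [if_pos h3, if_neg (not_lt.2 h3.le)]; ring
    · rw [if_neg h, if_neg (fun h' => h ⟨h'.2.1, h'.1, h'.2.2.symm⟩), neg_zero]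
  have h3 : ∑ v, ∑ u, T v u = - ∑ v, ∑ u, T v u := by
    conv_lhs => rw [Finset.sum_comm]
    rw [← Finset.sum_neg_distrib]
    refine Finset.sum_congr rfl fun v _ => ?_
    rw [← Finset.sum_neg_distrib]
    exact Finset.sum_congr rfl fun u _ => h2 u v
  rw [h1]; linarith

def ext (K : Finset (Finset V)) (c : ℕ) (f : Chains K c ℝ) (s : Finset V) : ℝ :=
  if h : s ∈ K ∧ s.card = c then f ⟨s, h⟩ else 0

lemma cb_eq (K : Finset (Finset V)) (c : ℕ) (f : Chains K (c+1) ℝ) (τ : {s : Finset V // s ∈ K ∧ s.card = c}) :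
    chainBoundary K c f τ = rb (ext K (c+1) f) τ.1 := by
  unfold chainBoundary rb
  refine Finset.sum_congr rfl fun v _ => ?_
  by_cases h1 : v ∈ τ.1
  · simp [h1]
  · have hc : (insert v τ.1).card = c + 1 := by rw [card_insert_of_notMem h1, τ.2.2]
    by_cases h2 : insert v τ.1 ∈ K
    · simp [h1, h2, ext, hc, sg]
    · simp [h1, h2, ext]

lemma rb_congr (f g : Finset V → ℝ) (τ : Finset V) (h : ∀ v, v ∉ τ → f (insert v τ) = g (insert v τ)) :
    rb f τ = rb g τ := by
  unfold rb
  refine Finset.sum_congr rfl fun v _ => ?_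
  split_ifs with h1
  swap
  · rw [h v h1]
  · rfl

lemma chi {α β : Type} [Fintype α] (c : α → ℝ) (a0 : α) (h0 : c a0 ≠ 0) :
    ∃ χ : α → ZMod 2, (∃ a, χ a ≠ 0) ∧ (∀ a, c a = 0 → χ a = 0) ∧
      ∀ (s : Finset β) (ε : β → ℤ) (g : β → α), (∀ u, ε u = 1 ∨ ε u = -1) →
        ∑ u ∈ s, ε u • c (g u) = 0 → ∑ u ∈ s, χ (g u) = 0 := by
  classical
  let M : Submodule ℤ ℝ := Submodule.span ℤ (Set.range c)
  haveI : Module.Finite ℤ M := Module.Finite.span_of_finite ℤ (Set.finite_range c)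
  haveI : Module.Free ℤ M := inferInstance
  let b := Module.Free.chooseBasis ℤ M
  let cM : α → M := fun a => ⟨c a, Submodule.subset_span ⟨a, rfl⟩⟩
  have hne : Nonempty (Module.Free.ChooseBasisIndex ℤ M) := by
    by_contra hemp
    rw [not_nonempty_iff] at hemp
    haveI := hemp
    have h1 : cM a0 = 0 := b.ext_elem (fun i => (hemp.false i).elim)
    exact h0 (congrArg Subtype.val h1)
  obtain ⟨i⟩ := hne
  let ψ : M →ₗ[ℤ] ℤ := b.coord i
  refine ⟨fun a => ((ψ (cM a) : ℤ) : ZMod 2), ?_, ?_, ?_⟩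
  · by_contra hall
    push Not at hall
    have h2 : ∀ x : ℝ, ∀ hx : x ∈ M, ((ψ ⟨x, hx⟩ : ℤ) : ZMod 2) = 0 := by
      intro x hx
      induction hx using Submodule.span_induction with
      | mem x h =>
        obtain ⟨a, rfl⟩ := h
        exact hall a
      | zero =>
        have : (⟨0, M.zero_mem⟩ : M) = 0 := rfl
        erw [this]; simp
      | add x y hx hy ihx ihy =>
        have : (⟨x + y, M.add_mem hx hy⟩ : M) = ⟨x, hx⟩ + ⟨y, hy⟩ := rfl
        erw [this, map_add]; push_cast; rw [ihx, ihy, add_zero]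
      | smul r x hx ih =>
        have : (⟨r • x, M.smul_mem r hx⟩ : M) = r • ⟨x, hx⟩ := rfl
        erw [this, map_smul]; rw [smul_eq_mul]; push_cast; rw [ih, mul_zero]
    have h3 := h2 (b i).1 (b i).2
    have h4 : ψ (b i) = 1 := by simp [ψ]
    rw [show (⟨(b i).1, (b i).2⟩ : M) = b i from rfl, h4] at h3
    exact absurd h3 (by decide)
  · intro a ha
    have : cM a = 0 := Subtype.ext ha
    simp [this]
  · intro s ε g hε hs
    have h1 : ∑ u ∈ s, ε u • cM (g u) = 0 := by
      apply Subtype.ext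
      rw [Submodule.coe_sum]
      simpa [cM] using hs
    have h2 := congrArg ψ h1
    rw [map_sum, map_zero] at h2
    have h3 := congrArg (fun z : ℤ => (z : ZMod 2)) h2
    simp only [map_smul, smul_eq_mul, Int.cast_sum, Int.cast_mul, Int.cast_zero] at h3
    rw [← h3]
    refine Finset.sum_congr rfl fun u _ => ?_
    rcases hε u with h | h <;> rw [h]
    · simp
    · rw [show ((-1 : ℤ) : ZMod 2) = 1 by decide, one_mul]
end

lemma mem_Y_low {n d : ℕ} {ω : FaceIdx n d → Bool} {s : Finset (Fin n)} (h : s.card ≤ d) :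
    s ∈ Ycomplex n d ω := by simp [Ycomplex, h]

lemma cb_cb_raw (n k : ℕ) (ω : FaceIdx n (k+1) → Bool) (F : Finset (Fin n) → ℝ) :
    chainBoundary (Ycomplex n (k+1) ω) k (fun s => rb F s.1) = 0 := by
  funext η
  rw [cb_eq, Pi.zero_apply, ← rb_rb F η.1]
  refine rb_congr _ _ _ fun v hv => ?_
  have hc : (insert v η.1).card = k + 1 := by rw [card_insert_of_notMem hv, η.2.2]
  rw [ext, dif_pos ⟨mem_Y_low hc.le, hc⟩]

lemma not_zero_of_isolated (n k : ℕ) (hk : k + 1 < n) (ω : FaceIdx n (k+1) → Bool)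
    (σ : Finset (Fin n)) (hσ : σ.card = k+1)
    (hiso : ∀ τ : FaceIdx n (k+1), σ ⊆ τ.1 → ω τ = false) :
    ¬ HomologyZero (Ycomplex n (k+1) ω) k ℝ := by
  intro H
  obtain ⟨v, hv⟩ : ∃ v, v ∉ σ := by
    by_contra h
    push Not at h
    have : σ = univ := eq_univ_iff_forall.2 h
    rw [this, card_univ, Fintype.card_fin] at hσ
    omega
  let F : Finset (Fin n) → ℝ := fun s => if s = insert v σ then 1 else 0
  obtain ⟨g, hg⟩ := H (fun s => rb F s.1) (cb_cb_raw n k ω F)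
  have h1 := congrFun hg ⟨σ, mem_Y_low hσ.le, hσ⟩
  have h2 : chainBoundary (Ycomplex n (k+1) ω) (k+1) g ⟨σ, mem_Y_low hσ.le, hσ⟩ = 0 := by
    unfold chainBoundary
    refine Finset.sum_eq_zero fun u _ => ?_
    rw [dif_neg]
    rintro ⟨hu, hK⟩
    simp only at hu hK
    have hc : (insert u σ).card = k + 1 + 1 := by rw [card_insert_of_notMem hu, hσ]
    simp only [Ycomplex, mem_filter, mem_univ, true_and] at hK
    rcases hK with hK | ⟨hK, hω⟩
    · omega
    · rw [hiso ⟨insert u σ, hK⟩ (subset_insert _ _)] at hω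
      exact absurd hω (by decide)
  rw [h2] at h1
  have h3 : rb F σ = (sg σ v : ℝ) := by
    unfold rb
    rw [Finset.sum_eq_single v]
    · simp [hv, F]
    · intro u _ huv
      split_ifs with h
      swap
      · have : insert u σ ≠ insert v σ := by
          intro e
          have : u ∈ insert v σ := by rw [← e]; exact mem_insert_self _ _
          rcases mem_insert.1 this with h' | h'
          · exact huv h'
          · exact h h'
        simp [F, this]
      · rfl
    · intro h; exact absurd (mem_univ _) h
  simp only [h3] at h1
  rcases sg_pm σ v with h | h <;> rw [h] at h1 <;> norm_num at h1

lemma zero_of_not_bad (n k : ℕ) (v0 : Fin n) (ω : FaceIdx n (k+1) → Bool)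
    (hω : ω ∉ Bad n (k+1) v0) : HomologyZero (Ycomplex n (k+1) ω) k ℝ := by
  classical
  set K := Ycomplex n (k+1) ω with hK
  let I := {σ : Finset (Fin n) // σ.card = k+1 ∧ v0 ∉ σ}
  let R : Chains K (k+2) ℝ →ₗ[ℝ] (I → ℝ) :=
    (LinearMap.funLeft ℝ ℝ (fun σ : I => (⟨σ.1, mem_Y_low σ.2.1.le, σ.2.1⟩ : {s // s ∈ K ∧ s.card = k+1}))).comp
      (chainBoundaryLin K (k+1))
  have hRapp : ∀ g (σ : I), R g σ = rb (ext K (k+2) g) σ.1 := by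
    intro g σ
    exact cb_eq K (k+1) g _
  have hR : LinearMap.range R = ⊤ := by
    by_contra hne
    obtain ⟨φ, hφ0, hφ⟩ := Submodule.exists_le_ker_of_lt_top _ (lt_top_iff_ne_top.2 hne)
    apply hω
    let c : Finset (Fin n) → ℝ := fun s => if h : s.card = k+1 ∧ v0 ∉ s then φ (Pi.single ⟨s, h⟩ 1) else 0
    have hφx : ∀ x : I → ℝ, φ x = ∑ σ : I, x σ * c σ.1 := by
      intro x
      conv_lhs => rw [pi_eq_sum_univ' x, map_sum]
      refine Finset.sum_congr rfl fun σ _ => ?_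
      rw [map_smul, smul_eq_mul]
      congr 1
      simp only [c]
      rw [dif_pos σ.2]



    obtain ⟨a0, ha0⟩ : ∃ a, c a ≠ 0 := by
      by_contra h
      push Not at h
      apply hφ0
      ext x
      simp [hφx, h]
    obtain ⟨χ, ⟨a, ha⟩, hχ0, hχ⟩ := chi (β := Fin n) c a0 ha0
    refine ⟨(powersetCard (k+1) univ).filter (fun s => χ s ≠ 0), filter_subset _ _, ?_, ?_, ?_⟩
    · refine ⟨a, ?_⟩
      have hca : c a ≠ 0 := fun h => ha (hχ0 a h)
      have : a.card = k+1 := by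
        by_contra h
        exact hca (by simp [c, h])
      simp [this, ha]
    · intro σ hσ hv
      rw [mem_filter] at hσ
      exact hσ.2 (hχ0 _ (by simp [c, hv]))
    · intro τ hτ
      by_contra htrue
      rw [Bool.not_eq_false] at htrue
      have hτK : τ.1 ∈ K ∧ τ.1.card = k + 2 := by
        refine ⟨?_, τ.2⟩
        simp only [hK, Ycomplex, mem_filter, mem_univ, true_and]
        exact Or.inr ⟨τ.2, htrue⟩
      let g : Chains K (k+2) ℝ := Pi.single ⟨τ.1, hτK⟩ 1
      have hext : ext K (k+2) g = fun s => if s = τ.1 then 1 else 0 := by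
        funext s
        unfold ext
        by_cases hs : s = τ.1
        · subst hs
          rw [dif_pos hτK]; simp [g]
        · simp only [hs, if_false]
          split_ifs with h
          · simp [g, Pi.single_apply, hs]
          · rfl
      have hz : φ (R g) = 0 := hφ ⟨g, rfl⟩
      rw [hφx] at hz
      simp_rw [hRapp, hext] at hz
      have hsum : ∑ u ∈ τ.1, sg (τ.1.erase u) u • c (τ.1.erase u) = 0 := by
        rw [← hz]
        unfold rb
        simp_rw [Finset.sum_mul]
        rw [Finset.sum_comm]
        have : ∀ u : Fin n, (∑ σ : I, (if u ∉ σ.1 then sg σ.1 u • (if insert u σ.1 = τ.1 then (1:ℝ) else 0) else 0) * c σ.1)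
            = if u ∈ τ.1 then sg (τ.1.erase u) u • c (τ.1.erase u) else 0 := by
          intro u
          split_ifs with hu
          · by_cases hv0 : v0 ∈ τ.1.erase u
            · have : c (τ.1.erase u) = 0 := by simp only [c]; rw [dif_neg (fun h => h.2 hv0)]
              rw [this, smul_zero]
              refine Finset.sum_eq_zero fun σ _ => ?_
              split_ifs with h1 h2
              swap
              · exfalso
                rw [← h2, erase_insert h1] at hv0
                exact σ.2.2 hv0
              · simp
              · simp
            · rw [Finset.sum_eq_single (⟨τ.1.erase u, by rw [card_erase_of_mem hu, τ.2]; rfl, hv0⟩ : I)]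
              · simp [insert_erase hu]
              · intro σ _ hσ
                split_ifs with h1 h2
                swap
                · exfalso
                  apply hσ
                  apply Subtype.ext
                  simp only
                  rw [← h2, erase_insert h1]
                · simp
                · simp
              · intro h; exact absurd (mem_univ _) h
          · refine Finset.sum_eq_zero fun σ _ => ?_
            split_ifs with h1 h2
            swap
            · exfalso
              apply hu; rw [← h2]; exact mem_insert_self _ _
            · simp
            · simp
        simp_rw [this]
        simp
      have h2 := hχ τ.1 (fun u => sg (τ.1.erase u) u) (fun u => τ.1.erase u) (fun u => sg_pm _ _) hsum
      rw [cobd, mem_filter] at hτ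
      apply hτ.2
      refine Eq.trans ?_ h2
      unfold dl
      refine Finset.sum_congr rfl fun u hu => ?_
      have hc : (τ.1.erase u).card = k+1 := by rw [card_erase_of_mem hu, τ.2]; rfl
      have h01 : ∀ z : ZMod 2, z ≠ 0 → z = 1 := by decide
      unfold ind
      simp only [mem_filter, mem_powersetCard, subset_univ, hc, true_and, and_true]
      split_ifs with h
      · exact (h01 _ h).symm
      · push Not at h; exact h.symm
  intro f hf
  obtain ⟨g, hg⟩ := LinearMap.range_eq_top.1 hR (fun σ => f ⟨σ.1, mem_Y_low σ.2.1.le, σ.2.1⟩)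
  refine ⟨g, ?_⟩
  have hdd : chainBoundaryLin K k (chainBoundaryLin K (k+1) g) = 0 := by
    have : chainBoundaryLin K (k+1) g = fun s => rb (ext K (k+2) g) s.1 := by
      funext s; exact cb_eq K (k+1) g s
    rw [this]; exact cb_cb_raw n k ω _
  set h := chainBoundaryLin K (k+1) g - f with hh
  have hcyc : chainBoundary K k h = 0 := by
    have : chainBoundaryLin K k h = 0 := by
      rw [hh, map_sub, hdd, zero_sub, neg_eq_zero]; exact hf
    exact this
  have hno : ∀ s : {s // s ∈ K ∧ s.card = k+1}, v0 ∉ s.1 → h s = 0 := by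
    intro s hs
    have := congrFun hg ⟨s.1, s.2.2, hs⟩
    rw [hh, Pi.sub_apply, sub_eq_zero]
    exact this
  have hzero : h = 0 := by
    funext s
    by_cases hs : v0 ∈ s.1
    · have hc : (s.1.erase v0).card = k := by rw [card_erase_of_mem hs, s.2.2]; rfl
      have h1 := congrFun hcyc ⟨s.1.erase v0, mem_Y_low (by omega), hc⟩
      rw [cb_eq] at h1
      unfold rb at h1
      rw [Finset.sum_eq_single v0] at h1
      · simp only at h1
        rw [if_pos (notMem_erase _ _), insert_erase hs, ext, dif_pos s.2] at h1
        rcases sg_pm (s.1.erase v0) v0 with h2 | h2 <;> rw [h2] at h1 <;> simpa using h1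
      · intro u _ hu
        split_ifs with h2
        swap
        · have : ext K (k+1) h (insert u (s.1.erase v0)) = 0 := by
            unfold ext
            split_ifs with h3
            · refine hno _ ?_
              simp [hu.symm]
            · rfl

          rw [this, smul_zero]
        · rfl
      · intro h; exact absurd (mem_univ _) h
    · exact hno s hs
  rw [hh, sub_eq_zero] at hzero
  exact hzero

end HV
end


noncomputable section
namespace HV
set_option linter.all false

lemma second_moment {Ω ι : Type} [Finite Ω] [MeasurableSpace Ω] [MeasurableSingletonClass Ω]
    (μ : Measure Ω) [IsProbabilityMeasure μ] (s : Finset ι) (A : ι → Set Ω) (a : ℝ) (c : ι → ι → ℝ)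
    (h1 : ∀ i ∈ s, μ.real (A i) = a) (h2 : ∀ i ∈ s, ∀ j ∈ s, μ.real (A i ∩ A j) ≤ c i j) :
    (s.card * a) ^ 2 * μ.real {ω | ∀ i ∈ s, ω ∉ A i} ≤ ∑ i ∈ s, ∑ j ∈ s, c i j - (s.card * a) ^ 2 := by
  classical
  have hm : ∀ S : Set Ω, MeasurableSet S := fun S => (Set.toFinite S).measurableSet
  set m : ℝ := s.card * a with hmdef
  let X : Ω → ℝ := fun ω => ∑ i ∈ s, (A i).indicator 1 ω
  have hX : ∫ ω, X ω ∂μ = m := by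
    simp only [X]
    rw [integral_finset_sum _ (fun i _ => Integrable.of_finite)]
    rw [Finset.sum_congr rfl (fun i hi => by rw [integral_indicator_one (hm _), h1 i hi])]
    simp [m]
  have hX2 : ∫ ω, X ω * X ω ∂μ ≤ ∑ i ∈ s, ∑ j ∈ s, c i j := by
    have e : ∀ ω, X ω * X ω = ∑ i ∈ s, ∑ j ∈ s, (A i ∩ A j).indicator 1 ω := by
      intro ω
      simp only [X, Finset.sum_mul_sum, Set.inter_indicator_one, Pi.mul_apply]
    simp_rw [e]
    rw [integral_finset_sum _ (fun i _ => Integrable.of_finite)]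
    refine Finset.sum_le_sum fun i hi => ?_
    rw [integral_finset_sum _ (fun i _ => Integrable.of_finite)]
    refine Finset.sum_le_sum fun j hj => ?_
    rw [integral_indicator_one (hm _)]
    exact h2 i hi j hj
  have h3 : ∫ ω, (X ω - m) ^ 2 ∂μ = ∫ ω, X ω * X ω ∂μ - m ^ 2 := by
    have e : ∀ ω, (X ω - m) ^ 2 = X ω * X ω - (2 * m * X ω - m ^ 2) := by intro ω; ring
    simp_rw [e]
    rw [integral_sub Integrable.of_finite Integrable.of_finite,
      integral_sub Integrable.of_finite Integrable.of_finite, integral_const_mul, hX, integral_const]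
    simp
    ring
  have h4 : m ^ 2 * μ.real {ω | ∀ i ∈ s, ω ∉ A i} ≤ ∫ ω, (X ω - m) ^ 2 ∂μ := by
    rw [← integral_indicator_one (hm _), ← integral_const_mul]
    refine integral_mono Integrable.of_finite Integrable.of_finite ?_
    intro ω
    by_cases h : ω ∈ {ω | ∀ i ∈ s, ω ∉ A i}
    · have hx : X ω = 0 := Finset.sum_eq_zero fun i hi => Set.indicator_of_notMem (h i hi) _
      simp only [Set.indicator_of_mem h, hx]
      simp
    · simp only [Set.indicator_of_notMem h]
      simp only [mul_zero]
      positivity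
  linarith

def Ts (n d : ℕ) (σ : Finset (Fin n)) : Finset (Finset (Fin n)) :=
  (powersetCard (d+1) univ).filter fun τ => σ ⊆ τ

lemma card_Ts (n d : ℕ) (σ : Finset (Fin n)) (h : σ.card = d) : (Ts n d σ).card = n - d := by
  have : Ts n d σ = (univ \ σ).image fun v => insert v σ := by
    ext τ
    simp only [Ts, mem_filter, mem_powersetCard, subset_univ, true_and, mem_image, Finset.mem_sdiff, mem_univ]
    constructor
    · rintro ⟨h1, h2⟩
      have : (τ \ σ).card = 1 := by rw [card_sdiff_of_subset h2]; omega
      obtain ⟨v, hv⟩ := card_eq_one.1 this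
      have hv' : v ∈ τ \ σ := by rw [hv]; simp
      refine ⟨v, (Finset.mem_sdiff.1 hv').2, ?_⟩
      rw [← sdiff_union_of_subset h2, hv]; rfl
    · rintro ⟨v, hv, rfl⟩
      exact ⟨by rw [card_insert_of_notMem hv, h], subset_insert _ _⟩
  rw [this, card_image_of_injOn]
  · rw [card_univ_sdiff, h, Fintype.card_fin]
  · intro v hv u hu e
    simp only [coe_sdiff, Set.mem_diff, mem_coe] at hv hu
    simp only at e
    have : v ∈ insert u σ := by rw [← e]; exact mem_insert_self _ _
    rcases mem_insert.1 this with h' | h'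
    · exact h'
    · exact absurd h' hv.2

lemma card_inter_Ts (n d : ℕ) (σ σ' : Finset (Fin n)) (h : σ.card = d) (h' : σ'.card = d) (hne : σ ≠ σ') :
    (Ts n d σ ∩ Ts n d σ').card ≤ if adj d σ σ' then 1 else 0 := by
  have key : ∀ τ ∈ Ts n d σ ∩ Ts n d σ', τ = σ ∪ σ' ∧ adj d σ σ' := by
    intro τ hτ
    simp only [Ts, mem_inter, mem_filter, mem_powersetCard, subset_univ, true_and] at hτ
    obtain ⟨⟨h1, h2⟩, -, h3⟩ := hτ
    have hsub : σ ∪ σ' ⊆ τ := union_subset h2 h3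
    have hlt : σ.card < (σ ∪ σ').card := by
      refine card_lt_card (Finset.ssubset_iff_subset_ne.2 ⟨subset_union_left, fun e => ?_⟩)
      have : σ' ⊆ σ := by rw [e]; exact subset_union_right
      exact hne (eq_of_subset_of_card_le this (by omega)).symm
    have hle := card_le_card hsub
    exact ⟨(eq_of_subset_of_card_le hsub (by omega)).symm, hne, by omega⟩
  split_ifs with ha
  · exact card_le_one.2 fun a ha b hb => (key a ha).1.trans (key b hb).1.symm
  · rw [Nat.le_zero, card_eq_zero]
    exact eq_empty_of_forall_notMem fun τ hτ => ha (key τ hτ).2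

def Iso (n d : ℕ) (σ : Finset (Fin n)) : Set (FaceIdx n d → Bool) :=
  {ω | ∀ τ : FaceIdx n d, τ.1 ∈ Ts n d σ → ω τ = false}

lemma var_bound (n d : ℕ) (hdn : d < n) (p : ℝ) (hP : cl p ≤ 1/2) :
    (YMeasure n d p).real {ω | ∀ σ ∈ powersetCard d (univ : Finset (Fin n)), ω ∉ Iso n d σ} ≤
      1 / ((n.choose d : ℝ) * (1 - cl p) ^ (n - d)) + 2 * cl p * d * n / (n.choose d) := by
  classical
  set P := cl p with hPdef
  set q := 1 - P with hq
  set r := n - d with hr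
  have hP0 : 0 ≤ P := cl_nonneg p
  have hq0 : 0 < q := by linarith
  have hq1 : q ≤ 1 := by linarith
  have hqh : 1/2 ≤ q := by linarith
  set N : ℝ := ((n.choose d : ℕ) : ℝ) with hN
  have hN0 : 0 < N := by rw [hN]; exact_mod_cast Nat.choose_pos hdn.le
  have hc : (powersetCard d (univ : Finset (Fin n))).card = n.choose d := by simp
  have hTsub : ∀ σ, Ts n d σ ⊆ powersetCard (d+1) univ := fun σ => filter_subset _ _
  have key := second_moment (YMeasure n d p) (powersetCard d (univ : Finset (Fin n))) (Iso n d) (q ^ r)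
    (fun σ σ' => q ^ (2 * r) + ((if σ = σ' then q ^ r else 0) + if σ' ∈ Nb d {σ} then 2 * q ^ (2 * r) * P else 0)) ?_ ?_
  · rw [hc] at key
    have hs : ∑ σ ∈ powersetCard d (univ : Finset (Fin n)), ∑ σ' ∈ powersetCard d (univ : Finset (Fin n)),
        (q ^ (2 * r) + ((if σ = σ' then q ^ r else 0) + if σ' ∈ Nb d {σ} then 2 * q ^ (2 * r) * P else 0))
        ≤ N * (N * q ^ (2 * r) + (q ^ r + d * n * (2 * q ^ (2 * r) * P))) := by
      rw [hN, ← hc, ← nsmul_eq_mul]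
      refine Finset.sum_le_card_nsmul _ _ _ fun σ hσ => ?_
      rw [Finset.sum_add_distrib, Finset.sum_add_distrib, Finset.sum_const, nsmul_eq_mul]
      refine add_le_add le_rfl (add_le_add ?_ ?_)
      · rw [Finset.sum_ite_eq, if_pos hσ]
      · rw [← Finset.sum_filter, Finset.sum_const, nsmul_eq_mul]
        refine mul_le_mul_of_nonneg_right ?_ (by positivity)
        have h1 := card_Nb d {σ} (by simpa using hσ)
        rw [card_singleton, one_mul, Fintype.card_fin] at h1
        have h2 : ((powersetCard d (univ : Finset (Fin n))).filter fun σ' => σ' ∈ Nb d {σ}).card ≤ (Nb d {σ}).card :=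
          card_le_card fun x hx => (mem_filter.1 hx).2
        exact_mod_cast h2.trans h1
    have hm : 0 < N * q ^ r := by positivity
    have hkey2 := key.trans (sub_le_sub_right hs _)
    set Z := (YMeasure n d p).real {ω | ∀ σ ∈ powersetCard d (univ : Finset (Fin n)), ω ∉ Iso n d σ}
    have e : N * (N * q ^ (2 * r) + (q ^ r + d * n * (2 * q ^ (2 * r) * P))) - (N * q ^ r) ^ 2 =
        (N * q ^ r) ^ 2 * (1 / (N * q ^ r) + 2 * P * d * n / N) := by
      have : q ^ r ≠ 0 := by positivity
      have : N ≠ 0 := hN0.ne'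
      rw [pow_mul']
      field_simp
      ring
    rw [e] at hkey2
    exact le_of_mul_le_mul_left hkey2 (by positivity)
  · intro σ hσ
    rw [Measure.real, Iso, Y_none n d p _ (hTsub σ), ENNReal.toReal_ofReal (by positivity),
      card_Ts n d σ (mem_powersetCard.1 hσ).2]
  · intro σ hσ σ' hσ'
    have hσc := (mem_powersetCard.1 hσ).2
    have hσc' := (mem_powersetCard.1 hσ').2
    have e : Iso n d σ ∩ Iso n d σ' = {ω | ∀ τ : FaceIdx n d, τ.1 ∈ Ts n d σ ∪ Ts n d σ' → ω τ = false} := by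
      ext ω
      simp only [Iso, Set.mem_inter_iff, Set.mem_ofPred_eq, mem_union]
      exact ⟨fun h τ hτ => hτ.elim (h.1 τ) (h.2 τ), fun h => ⟨fun τ hτ => h τ (Or.inl hτ), fun τ hτ => h τ (Or.inr hτ)⟩⟩
    rw [Measure.real, e, Y_none n d p _ (union_subset (hTsub σ) (hTsub σ')), ENNReal.toReal_ofReal (by positivity)]
    have hu := card_union_add_card_inter (Ts n d σ) (Ts n d σ')
    rw [card_Ts n d σ hσc, card_Ts n d σ' hσc'] at hu
    have hpp : 0 ≤ q ^ (2 * r) := by positivity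
    have hpr : 0 ≤ q ^ r := by positivity
    by_cases hne : σ = σ'
    · subst hne
      rw [if_pos rfl, union_self, card_Ts n d σ hσc]
      have : 0 ≤ (if σ ∈ Nb d {σ} then 2 * q ^ (2 * r) * P else 0) := by split_ifs <;> positivity
      change q ^ r ≤ _
      linarith
    · have hi := card_inter_Ts n d σ σ' hσc hσc' hne
      rw [if_neg hne]
      by_cases ha : adj d σ σ'
      · have hmem : σ' ∈ Nb d {σ} := by
          simp only [Nb, mem_filter]; exact ⟨hσ', σ, mem_singleton_self _, ha⟩
        rw [if_pos ha] at hi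
        rw [if_pos hmem]
        have h1 : 2 * r - 1 ≤ (Ts n d σ ∪ Ts n d σ').card := by omega
        refine (pow_le_pow_of_le_one hq0.le hq1 h1).trans ?_
        have h2 : q ^ (2 * r) = q ^ (2 * r - 1) * q := by rw [← pow_succ]; congr 1; omega
        have h3 : 0 ≤ q ^ (2 * r - 1) := by positivity
        rw [h2]
        have h4 : 1 ≤ q + 2 * q * P := by nlinarith
        nlinarith
      · rw [if_neg ha] at hi
        have h1 : 2 * r ≤ (Ts n d σ ∪ Ts n d σ').card := by omega
        refine (pow_le_pow_of_le_one hq0.le hq1 h1).trans ?_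
        have : 0 ≤ (if σ' ∈ Nb d {σ} then 2 * q ^ (2 * r) * P else 0) := by split_ifs <;> positivity
        linarith

lemma choose_lower (d : ℕ) (hd : 1 ≤ d) : ∃ c : ℝ, 0 < c ∧ ∀ n : ℕ, 2 * d ≤ n → c * (n:ℝ) ^ d ≤ n.choose d := by
  refine ⟨1 / (2 ^ d * d.factorial), by positivity, fun n hn => ?_⟩
  have h1 : ((n + 1 - d : ℕ) : ℝ) ^ d / d.factorial ≤ n.choose d := by
    exact_mod_cast Nat.pow_le_choose (α := ℝ) d n
  refine le_trans ?_ h1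
  have h2 : (n:ℝ) / 2 ≤ ((n + 1 - d : ℕ) : ℝ) := by
    have : n ≤ 2 * (n + 1 - d) := by omega
    have : (n:ℝ) ≤ 2 * ((n + 1 - d : ℕ) : ℝ) := by exact_mod_cast this
    linarith
  calc 1 / (2 ^ d * (d.factorial:ℝ)) * (n:ℝ) ^ d = ((n:ℝ)/2) ^ d / d.factorial := by
        rw [div_pow]; field_simp
    _ ≤ _ := by gcongr

lemma lim2 (d : ℕ) (hd : 1 ≤ d) (w : ℕ → ℝ) (hw : Tendsto w atTop atTop) (p : ℕ → ℝ)
    (hp : ∀ n : ℕ, p n ≤ (d * Real.log n - w n) / n) :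
    (∀ᶠ n : ℕ in atTop, cl (p n) ≤ 1/2) ∧
    Tendsto (fun n : ℕ => 1 / ((n.choose d : ℝ) * (1 - cl (p n)) ^ (n - d)) + 2 * cl (p n) * d * n / (n.choose d))
      atTop (nhds 0) := by
  obtain ⟨c, hc, hch⟩ := choose_lower d hd
  have hlog : Tendsto (fun n : ℕ => Real.log n) atTop atTop :=
    Real.tendsto_log_atTop.comp tendsto_natCast_atTop_atTop
  have hl1 : Tendsto (fun n : ℕ => Real.log n / n) atTop (nhds 0) := by
    have := Real.isLittleO_log_id_atTop.tendsto_div_nhds_zero.comp (tendsto_natCast_atTop_atTop (R := ℝ))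
    exact this
  have hl2 : Tendsto (fun n : ℕ => Real.log n ^ 2 / n) atTop (nhds 0) := by
    have := (Real.isLittleO_pow_log_id_atTop (n := 2)).tendsto_div_nhds_zero.comp (tendsto_natCast_atTop_atTop (R := ℝ))
    exact this
  have hdl1 : Tendsto (fun n : ℕ => d * (Real.log n / n)) atTop (nhds 0) := by simpa using hl1.const_mul (d:ℝ)
  have hdl2 : Tendsto (fun n : ℕ => 2 * d ^ 2 * (Real.log n ^ 2 / n)) atTop (nhds 0) := by
    simpa using hl2.const_mul (2 * (d:ℝ) ^ 2)
  have hdl3 : Tendsto (fun n : ℕ => 2 * d ^ 2 / c * (Real.log n / n)) atTop (nhds 0) := by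
    simpa using hl1.const_mul (2 * (d:ℝ) ^ 2 / c)
  have hcl : ∀ᶠ n : ℕ in atTop, (n:ℝ) * cl (p n) ≤ max 0 (d * Real.log n - w n) := by
    filter_upwards [eventually_ge_atTop 1] with n hn
    have hn0 : (0:ℝ) < n := by exact_mod_cast hn
    have h1 : cl (p n) ≤ max 0 (p n) := max_le_max le_rfl (min_le_left _ _)
    have h2 : (n:ℝ) * p n ≤ d * Real.log n - w n := by
      have := hp n; rw [le_div_iff₀ hn0] at this; linarith
    calc (n:ℝ) * cl (p n) ≤ n * max 0 (p n) := by gcongr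
      _ = max 0 (n * p n) := by rw [mul_max_of_nonneg _ _ hn0.le, mul_zero]
      _ ≤ _ := max_le_max le_rfl h2
  have hcl2 : ∀ᶠ n : ℕ in atTop, (n:ℝ) * cl (p n) ≤ d * Real.log n := by
    filter_upwards [hcl, eventually_ge_atTop 1, hw.eventually_ge_atTop 0] with n h1 hn hw0
    have : 0 ≤ Real.log n := Real.log_nonneg (by exact_mod_cast hn)
    exact h1.trans (max_le (by positivity) (by linarith))
  have hhalf : ∀ᶠ n : ℕ in atTop, cl (p n) ≤ 1/2 := by
    filter_upwards [hcl2, eventually_ge_atTop 1, hdl1.eventually_le_const (show (0:ℝ) < 1/2 by norm_num)] with n h1 hn h2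
    have hn0 : (0:ℝ) < n := by exact_mod_cast hn
    refine le_trans ?_ h2
    rw [← mul_div_assoc, le_div_iff₀ hn0]; linarith
  refine ⟨hhalf, ?_⟩
  have hmin : Tendsto (fun n : ℕ => min (d * Real.log n) (w n)) atTop atTop := by
    have h1 : Tendsto (fun n : ℕ => d * Real.log n) atTop atTop := hlog.const_mul_atTop (by exact_mod_cast hd)
    rw [tendsto_atTop] at hw h1 ⊢
    intro b
    filter_upwards [hw b, h1 b] with n h1 h2 using le_min h2 h1
  have hinf : Tendsto (fun n : ℕ => (n.choose d : ℝ) * (1 - cl (p n)) ^ (n - d)) atTop atTop := by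
    have hE : Tendsto (fun n : ℕ => (c * Real.exp (-1)) * Real.exp (min (d * Real.log n) (w n))) atTop atTop :=
      (Real.tendsto_exp_atTop.comp hmin).const_mul_atTop (by positivity)
    refine tendsto_atTop_mono' _ ?_ hE
    filter_upwards [hcl, hcl2, hhalf, eventually_ge_atTop (2 * d),
      hdl2.eventually_le_const (show (0:ℝ) < 1 by norm_num)] with n h1 h2 h3 hn h4
    have hn1 : 1 ≤ n := by omega
    have hn0 : (0:ℝ) < n := by exact_mod_cast hn1
    set P := cl (p n)
    have hP0 : 0 ≤ P := cl_nonneg _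
    have hq0 : 0 < 1 - P := by linarith
    have hexp : Real.exp (-(P + 2 * P ^ 2)) ≤ 1 - P := by
      have g1 := Real.add_one_le_exp (P / (1 - P))
      have g2 : P / (1 - P) + 1 = (1 - P)⁻¹ := by field_simp; ring
      have g3 : P / (1 - P) ≤ P + 2 * P ^ 2 := by
        rw [div_le_iff₀ hq0]; nlinarith [mul_nonneg hP0 hP0]
      rw [g2] at g1
      rw [Real.exp_neg]
      exact inv_le_of_inv_le₀ hq0 (g1.trans (Real.exp_le_exp.2 g3))
    have hqn : Real.exp (-(n * P) - 1) ≤ (1 - P) ^ (n - d) := by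
      have g1 : (1 - P) ^ n ≤ (1 - P) ^ (n - d) :=
        pow_le_pow_of_le_one hq0.le (by linarith) (Nat.sub_le _ _)
      have g2 : Real.exp (-(P + 2 * P ^ 2)) ^ n ≤ (1 - P) ^ n := by gcongr
      rw [← Real.exp_nat_mul] at g2
      refine le_trans (Real.exp_le_exp.2 ?_) (g2.trans g1)
      have g3 : (n * P) ^ 2 ≤ (d * Real.log n) ^ 2 := by gcongr
      have g4 : 2 * n * P ^ 2 ≤ 2 * d ^ 2 * (Real.log n ^ 2 / n) := by
        rw [← mul_div_assoc, le_div_iff₀ hn0]; nlinarith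
      nlinarith
    have hpow : (n:ℝ) ^ d = Real.exp (d * Real.log n) := by
      rw [Real.exp_nat_mul, Real.exp_log hn0]
    calc c * Real.exp (-1) * Real.exp (min (d * Real.log n) (w n))
        ≤ c * Real.exp (-1) * Real.exp (d * Real.log n - n * P) := by
          gcongr
          rcases le_total 0 (d * Real.log n - w n) with h | h
          · rw [max_eq_right h] at h1
            have := min_le_right (d * Real.log n) (w n); linarith
          · rw [max_eq_left h] at h1
            have := min_le_left (d * Real.log n) (w n); linarith
      _ = (c * (n:ℝ) ^ d) * Real.exp (-(n * P) - 1) := by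
          rw [hpow, mul_assoc, mul_assoc, ← Real.exp_add, ← Real.exp_add]; congr 2; ring
      _ ≤ _ := by
          refine mul_le_mul (hch n hn) hqn (Real.exp_pos _).le (by positivity)
  have hfirst := hinf.inv_tendsto_atTop
  have hsec : Tendsto (fun n : ℕ => 2 * cl (p n) * d * n / (n.choose d : ℝ)) atTop (nhds 0) := by
    refine tendsto_of_tendsto_of_tendsto_of_le_of_le' tendsto_const_nhds hdl3 ?_ ?_
    · exact Eventually.of_forall fun n => by have := cl_nonneg (p n); positivity
    · filter_upwards [hcl2, eventually_ge_atTop (2 * d)] with n h1 hn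
      have hn1 : 1 ≤ n := by omega
      have hn0 : (0:ℝ) < n := by exact_mod_cast hn1
      have hN := hch n hn
      have hnd : (n:ℝ) ≤ (n:ℝ) ^ d := le_self_pow₀ (by exact_mod_cast hn1) (by omega)
      have hcN : c * n ≤ n.choose d := (mul_le_mul_of_nonneg_left hnd hc.le).trans hN
      have hP := cl_nonneg (p n)
      calc 2 * cl (p n) * d * n / (n.choose d : ℝ) ≤ 2 * cl (p n) * d * n / (c * n) := by gcongr
        _ = (2 * d) * (n * cl (p n)) / (c * n) := by ring
        _ ≤ (2 * d) * (d * Real.log n) / (c * n) := by gcongr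
        _ = _ := by field_simp
  have := hfirst.add hsec
  simpa [one_div] using this

theorem part1 (k : ℕ) (w : ℕ → ℝ) (hw : Tendsto w atTop atTop) (p : ℕ → ℝ)
    (hp : ∀ n : ℕ, ((k+1 : ℕ) * Real.log n + w n) / n ≤ p n) :
    Tendsto (fun n : ℕ => YMeasure n (k+1) (p n)
          {ω | HomologyZero (Ycomplex n (k+1) ω) k ℝ}) atTop (nhds (1 : ENNReal)) := by
  have h1 := ENNReal.tendsto_ofReal (bad_tendsto (k+1) (by omega) w hw p hp)
  rw [ENNReal.ofReal_zero] at h1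
  have h2 := ENNReal.Tendsto.sub (tendsto_const_nhds (x := (1:ENNReal))) h1 (Or.inl ENNReal.one_ne_top)
  rw [tsub_zero] at h2
  refine tendsto_of_tendsto_of_tendsto_of_le_of_le' h2 tendsto_const_nhds ?_ (Eventually.of_forall fun n => prob_le_one)
  filter_upwards [eventually_ge_atTop 1] with n hn
  let v0 : Fin n := ⟨0, hn⟩
  have hsub : (Bad n (k+1) v0)ᶜ ⊆ {ω | HomologyZero (Ycomplex n (k+1) ω) k ℝ} :=
    fun ω hω => zero_of_not_bad n k v0 ω hω
  refine le_trans ?_ (measure_mono hsub)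
  rw [prob_compl_eq_one_sub (Set.toFinite _).measurableSet]
  exact tsub_le_tsub_left (Bad_le n (k+1) v0 (p n)) _

theorem part2 (k : ℕ) (w : ℕ → ℝ) (hw : Tendsto w atTop atTop) (p : ℕ → ℝ)
    (hp : ∀ n : ℕ, p n ≤ ((k+1 : ℕ) * Real.log n - w n) / n) :
    Tendsto (fun n : ℕ => YMeasure n (k+1) (p n)
          {ω | ¬ HomologyZero (Ycomplex n (k+1) ω) k ℝ}) atTop (nhds (1 : ENNReal)) := by
  obtain ⟨hh, hl⟩ := lim2 (k+1) (by omega) w hw p hp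
  have h1 := ENNReal.tendsto_ofReal hl
  rw [ENNReal.ofReal_zero] at h1
  have h2 := ENNReal.Tendsto.sub (tendsto_const_nhds (x := (1:ENNReal))) h1 (Or.inl ENNReal.one_ne_top)
  rw [tsub_zero] at h2
  refine tendsto_of_tendsto_of_tendsto_of_le_of_le' h2 tendsto_const_nhds ?_ (Eventually.of_forall fun n => prob_le_one)
  filter_upwards [eventually_gt_atTop (k+1), hh] with n hn hP
  have hb := var_bound n (k+1) hn (p n) hP
  set Z := {ω | ∀ σ ∈ powersetCard (k+1) (univ : Finset (Fin n)), ω ∉ Iso n (k+1) σ} with hZ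
  have hsub : Zᶜ ⊆ {ω | ¬ HomologyZero (Ycomplex n (k+1) ω) k ℝ} := by
    intro ω hω
    simp only [hZ, Set.mem_compl_iff, Set.mem_ofPred_eq] at hω
    push Not at hω
    obtain ⟨σ, hσ, hi⟩ := hω
    refine not_zero_of_isolated n k hn ω σ (mem_powersetCard.1 hσ).2 fun τ hτ => ?_
    exact hi τ (mem_filter.2 ⟨mem_powersetCard.2 ⟨subset_univ _, τ.2⟩, hτ⟩)
  refine le_trans ?_ (measure_mono hsub)
  rw [prob_compl_eq_one_sub (Set.toFinite _).measurableSet]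
  refine tsub_le_tsub_left ?_ _
  rw [← ofReal_measureReal]
  exact ENNReal.ofReal_le_ofReal hb

end HV
end

noncomputable section
/-- **Homology vanishing over `ℝ` for random `d`-complexes** (Hoffman–Kahle–Paquette).
Fix `d ≥ 1`. If `p ≥ (d log n + ω(n))/n` then w.h.p. `H_{d−1}(Y_d(n,p), ℝ) = 0`
(reduced when `d = 1`), and if `p ≤ (d log n − ω(n))/n` then w.h.p.
`H_{d−1}(Y_d(n,p), ℝ) ≠ 0`. -/
theorem homology_vanishing_real (d : ℕ) (hd : 1 ≤ d)
    (w : ℕ → ℝ) (hw : Tendsto w atTop atTop) (p : ℕ → ℝ) :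
    ((∀ n : ℕ, (d * Real.log n + w n) / n ≤ p n) →
      Tendsto (fun n : ℕ => YMeasure n d (p n)
          {ω | HomologyZero (Ycomplex n d ω) (d - 1) ℝ})
        atTop (nhds (1 : ENNReal))) ∧
    ((∀ n : ℕ, p n ≤ (d * Real.log n - w n) / n) →
      Tendsto (fun n : ℕ => YMeasure n d (p n)
          {ω | ¬ HomologyZero (Ycomplex n d ω) (d - 1) ℝ})
        atTop (nhds (1 : ENNReal))) := by
  obtain ⟨k, rfl⟩ : ∃ k, d = k + 1 := ⟨d - 1, by omega⟩
  exact ⟨fun hp => HV.part1 k w hw p hp, fun hp => HV.part2 k w hw p hp⟩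
end
end
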